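/- arXiv:1404.1356 — 4 statements merged into one kernel-verified Lean document; each statement's English description precedes it below -/
import Mathlib

section
/- Let (M_t)_{t=0}^n be a real-valued martingale with respect to a filtration (ℱ_t)_{t=0}^n on a probability space, with M_0 = 0, and suppose its differences ΔM_t = M_t − M_{t−1} satisfy ΔM_t ≥ −1/2 almost surely for all 1 ≤ t ≤ n. Then E[exp(M_n − [M]_n)] ≤ 1, where [M]_n = Σ_{t=1}^n (ΔM_t)² is the quadratic variation. -/
open MeasureTheory Finset

/-- The elementary inequality `exp (x - x²) ≤ 1 + x`, valid for `x ≥ -1/2`. -/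
theorem exp_sub_sq_le_one_add {x : ℝ} (hx : -(1 / 2 : ℝ) ≤ x) :
    Real.exp (x - x ^ 2) ≤ 1 + x := by
  rcases le_total 0 x with h | h
  · have hlog : 1 - (1 + x)⁻¹ ≤ Real.log (1 + x) := Real.one_sub_inv_le_log_of_pos (by linarith)
    have hsub : x - x ^ 2 ≤ 1 - (1 + x)⁻¹ := by
      have heq : 1 - (1 + x)⁻¹ - (x - x ^ 2) = x ^ 3 / (1 + x) := by
        field_simp
        ring
      have hpos : 0 ≤ x ^ 3 / (1 + x) := by positivity
      linarith
    exact (Real.le_log_iff_exp_le (by linarith)).1 (hsub.trans hlog)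
  · obtain ⟨y, rfl⟩ : ∃ y, x = -y := ⟨-x, by ring⟩
    have hy0 : 0 ≤ y := by linarith
    have hy : y ≤ 1 / 2 := by linarith
    have hexp := Real.quadratic_le_exp_of_nonneg (x := y + y ^ 2) (by positivity)
    have hmul : 1 ≤ (1 - y) * (1 + (y + y ^ 2) + (y + y ^ 2) ^ 2 / 2) := by
      have hy2 : y ^ 2 ≤ 1 / 4 := by nlinarith
      have hy3 : y ^ 3 ≤ 1 / 8 := by nlinarith
      have hrem : 0 ≤ y ^ 2 * (1 - y - y ^ 2 - y ^ 3) := by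
        apply mul_nonneg <;> nlinarith
      nlinarith
    have hle : 1 ≤ (1 - y) * Real.exp (y + y ^ 2) :=
      hmul.trans (mul_le_mul_of_nonneg_left hexp (by linarith))
    have heq : -y - (-y) ^ 2 = -(y + y ^ 2) := by ring
    rw [heq, Real.exp_neg, inv_le_iff_one_le_mul₀ (Real.exp_pos _)]
    linarith

/-- A bounded adapted process integrates to zero against the next increment of a martingale. -/
theorem MeasureTheory.Martingale.integral_mul_sub_eq_zero
    {Ω : Type*} {m0 : MeasurableSpace Ω} {μ : Measure Ω} [IsFiniteMeasure μ]
    {ℱ : Filtration ℕ m0} {M : ℕ → Ω → ℝ} (hM : Martingale M ℱ μ) {k : ℕ} {Z : Ω → ℝ}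
    (hZ : StronglyMeasurable[ℱ k] Z) (hZM : Integrable (Z * (M (k + 1) - M k)) μ) :
    ∫ ω, Z ω * (M (k + 1) ω - M k ω) ∂μ = 0 := by
  have hD : Integrable (M (k + 1) - M k) μ := (hM.integrable _).sub (hM.integrable _)
  have hcond : μ[M (k + 1) - M k | ℱ k] =ᵐ[μ] 0 := by
    filter_upwards [condExp_sub (hM.integrable (k + 1)) (hM.integrable k) (ℱ k),
      hM.condExp_ae_eq k.le_succ, hM.condExp_ae_eq (le_refl k)] with ω h₁ h₂ h₃
    simp_all
  have hprod : μ[Z * (M (k + 1) - M k) | ℱ k] =ᵐ[μ] 0 := by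
    filter_upwards [condExp_mul_of_stronglyMeasurable_left hZ hZM hD, hcond] with ω h₁ h₂
    simp [h₁, h₂]
  calc ∫ ω, Z ω * (M (k + 1) ω - M k ω) ∂μ
      = ∫ ω, (μ[Z * (M (k + 1) - M k) | ℱ k]) ω ∂μ := (integral_condExp (ℱ.le k)).symm
    _ = 0 := by simp [integral_congr_ae hprod]

/-- **Empirical Bernstein inequality for martingales.**
Let `(M_t)_{t=0}^n` be a real-valued martingale with `M 0 = 0` whose differences
`ΔM_t = M t - M (t-1)` satisfy `ΔM_t ≥ -1/2` a.s. for all `1 ≤ t ≤ n`. Then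
`E[exp(M_n - [M]_n)] ≤ 1` where `[M]_n = ∑_{t=1}^n (ΔM_t)^2`. -/
theorem empirical_bernstein_martingale
    {Ω : Type*} {m0 : MeasurableSpace Ω} {μ : Measure Ω} [IsProbabilityMeasure μ]
    (n : ℕ) (ℱ : Filtration ℕ m0) (M : ℕ → Ω → ℝ)
    (hM : Martingale M ℱ μ) (hM0 : M 0 = 0)
    (hdiff : ∀ t ∈ Finset.Icc 1 n, ∀ᵐ ω ∂μ, -(1/2 : ℝ) ≤ M t ω - M (t - 1) ω) :
    ∫ ω, Real.exp (M n ω - ∑ t ∈ Finset.Icc 1 n, (M t ω - M (t - 1) ω) ^ 2) ∂μ ≤ 1 := by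
  set Z : ℕ → Ω → ℝ := fun k ω =>
    Real.exp (M k ω - ∑ t ∈ Finset.Icc 1 k, (M t ω - M (t - 1) ω) ^ 2) with hZdef
  have hZ_zero (ω : Ω) : Z 0 ω = 1 := by simp [hZdef, hM0]
  have hZ_succ (k : ℕ) (ω : Ω) : Z (k + 1) ω =
      Z k ω * Real.exp ((M (k + 1) ω - M k ω) - (M (k + 1) ω - M k ω) ^ 2) := by
    simp only [hZdef]
    rw [← Real.exp_add, Finset.sum_Icc_succ_top (by omega), Nat.add_sub_cancel]
    congr 1
    ring
  have hZ_pos (k : ℕ) (ω : Ω) : 0 < Z k ω := Real.exp_pos _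
  have hZ_le (k : ℕ) (ω : Ω) : Z k ω ≤ Real.exp (1 / 4) ^ k := by
    induction k with
    | zero => simp [hZ_zero]
    | succ k ih =>
      rw [hZ_succ, pow_succ _ k]
      refine mul_le_mul ih (Real.exp_le_exp.2 ?_) (Real.exp_pos _).le (by positivity)
      nlinarith [sq_nonneg (M (k + 1) ω - M k ω - 1 / 2)]
  have hM_meas {s k : ℕ} (h : s ≤ k) : Measurable[ℱ k] (M s) :=
    ((hM.stronglyAdapted s).mono (ℱ.mono h)).measurable
  have hZ_meas (k : ℕ) : StronglyMeasurable[ℱ k] (Z k) := by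
    refine Measurable.stronglyMeasurable (Real.measurable_exp.comp ?_)
    refine (hM_meas le_rfl).sub (Finset.measurable_fun_sum _ fun t ht => ?_)
    have htk := (Finset.mem_Icc.1 ht).2
    exact ((hM_meas htk).sub (hM_meas (by omega))).pow_const 2
  have hZ_bound (k : ℕ) : ∀ᵐ ω ∂μ, ‖Z k ω‖ ≤ Real.exp (1 / 4) ^ k :=
    Filter.Eventually.of_forall fun ω => by
      rw [Real.norm_of_nonneg (hZ_pos k ω).le]
      exact hZ_le k ω
  have hZ_aesm (k : ℕ) : AEStronglyMeasurable (Z k) μ :=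
    ((hZ_meas k).mono (ℱ.le k)).aestronglyMeasurable
  have hZ_int (k : ℕ) : Integrable (Z k) μ := Integrable.of_bound (hZ_aesm k) _ (hZ_bound k)
  have hmain (k : ℕ) (hk : k ≤ n) : ∫ ω, Z k ω ∂μ ≤ 1 := by
    induction k with
    | zero => simp [hZ_zero]
    | succ k ih =>
      have hZM : Integrable (Z k * (M (k + 1) - M k)) μ :=
        ((hM.integrable (k + 1)).sub (hM.integrable k)).bdd_mul (hZ_aesm k) (hZ_bound k)
      have hle : Z (k + 1) ≤ᵐ[μ] fun ω => Z k ω + Z k ω * (M (k + 1) ω - M k ω) := by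
        filter_upwards [hdiff (k + 1) (Finset.mem_Icc.2 ⟨by omega, hk⟩)] with ω hω
        rw [Nat.add_sub_cancel] at hω
        rw [hZ_succ]
        nlinarith [mul_le_mul_of_nonneg_left (exp_sub_sq_le_one_add hω) (hZ_pos k ω).le]
      calc ∫ ω, Z (k + 1) ω ∂μ
          ≤ ∫ ω, (Z k ω + Z k ω * (M (k + 1) ω - M k ω)) ∂μ :=
            integral_mono_ae (hZ_int _) ((hZ_int k).add hZM) hle
        _ = ∫ ω, Z k ω ∂μ + ∫ ω, Z k ω * (M (k + 1) ω - M k ω) ∂μ :=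
            integral_add (hZ_int k) hZM
        _ = ∫ ω, Z k ω ∂μ := by rw [hM.integral_mul_sub_eq_zero (hZ_meas k) hZM, add_zero]
        _ ≤ 1 := ih (by omega)
  exact hmain n le_rfl
end

section
/- Let M ≥ 1, let P = (P_j)_{j=1}^M be a probability vector with P_j > 0 for all j, and let h, g : {1,…,M} → ℝ. Then Σ_j P_j exp(h_j − Σ_i P_i h_i − g_j) ≤ 1 if and only if for every probability vector Q = (Q_j)_{j=1}^M one has Σ_j Q_j h_j − Σ_j P_j h_j ≤ Σ_j Q_j g_j + K(Q,P). -/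
open Finset

/-- The pointwise Young-type inequality between the entropy integrand and the exponential. -/
lemma mul_sub_entropy_le {p q : ℝ} (a : ℝ) (hp : 0 < p) (hq : 0 ≤ q) :
    q * a - (if 0 < q then q * Real.log (q / p) else 0) ≤ p * Real.exp a - q := by
  split_ifs with hq0
  · have hlog := Real.log_le_sub_one_of_pos (x := p * Real.exp a / q) (by positivity)
    have hlog_eq : Real.log (p * Real.exp a / q) = a - Real.log (q / p) := by
      rw [Real.log_div (by positivity) hq0.ne', Real.log_mul hp.ne' (Real.exp_ne_zero a),
        Real.log_exp, Real.log_div hq0.ne' hp.ne']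
      ring
    rw [hlog_eq] at hlog
    calc q * a - q * Real.log (q / p) = q * (a - Real.log (q / p)) := by ring
      _ ≤ q * (p * Real.exp a / q - 1) := mul_le_mul_of_nonneg_left hlog hq
      _ = p * Real.exp a - q := by field_simp
  · obtain rfl : q = 0 := le_antisymm (not_lt.mp hq0) hq
    simpa using (mul_pos hp (Real.exp_pos a)).le

/-- **Variational form of the entropy** on `{1,…,M}`: for a positive probability vector `P`
and functions `h`, `g`, one has `∑ⱼ Pⱼ exp(hⱼ - ∑ᵢ Pᵢ hᵢ - gⱼ) ≤ 1` if and only if for every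
probability vector `Q`, `∑ⱼ Qⱼ hⱼ - ∑ⱼ Pⱼ hⱼ ≤ ∑ⱼ Qⱼ gⱼ + K(Q,P)`, where
`K(Q,P) = ∑_{j : Qⱼ > 0} Qⱼ log(Qⱼ/Pⱼ)` is the relative entropy. -/
theorem variational_form_entropy (M : ℕ) (hM : 1 ≤ M)
    (P h g : Fin M → ℝ) (hPpos : ∀ j, 0 < P j) (hPsum : ∑ j, P j = 1) :
    (∑ j, P j * Real.exp (h j - ∑ i, P i * h i - g j) ≤ 1) ↔
      ∀ Q : Fin M → ℝ, (∀ j, 0 ≤ Q j) → ∑ j, Q j = 1 →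
        ∑ j, Q j * h j - ∑ j, P j * h j ≤
          ∑ j, Q j * g j + ∑ j, (if 0 < Q j then Q j * Real.log (Q j / P j) else 0) := by
  set m := ∑ i, P i * h i
  have sum_mul_exponent (Q : Fin M → ℝ) (hQsum : ∑ j, Q j = 1) :
      ∑ j, Q j * (h j - m - g j) = ∑ j, Q j * h j - m - ∑ j, Q j * g j := by
    simp only [mul_sub, sum_sub_distrib, ← sum_mul, hQsum, one_mul]
  constructor
  · intro hle Q hQ hQsum
    have hsum := sum_le_sum fun j (_ : j ∈ univ) =>
      mul_sub_entropy_le (h j - m - g j) (hPpos j) (hQ j)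
    simp only [sum_sub_distrib] at hsum
    linarith [sum_mul_exponent Q hQsum]
  · intro hQ
    set Z := ∑ j, P j * Real.exp (h j - m - g j) with hZ
    have hZpos : 0 < Z :=
      sum_pos (fun j _ => mul_pos (hPpos j) (Real.exp_pos _)) ⟨⟨0, hM⟩, mem_univ _⟩
    let Q : Fin M → ℝ := fun j => P j * Real.exp (h j - m - g j) / Z
    have hQpos (j) : 0 < Q j := div_pos (mul_pos (hPpos j) (Real.exp_pos _)) hZpos
    have hQsum : ∑ j, Q j = 1 := by
      rw [← sum_div, ← hZ, div_self hZpos.ne']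
    have hlog (j) : Real.log (Q j / P j) = (h j - m - g j) - Real.log Z := by
      have hdiv : Q j / P j = Real.exp (h j - m - g j) / Z := by
        have := (hPpos j).ne'
        simp only [Q]
        field_simp
      rw [hdiv, Real.log_div (Real.exp_ne_zero _) hZpos.ne', Real.log_exp]
    have hentropy : ∑ j, (if 0 < Q j then Q j * Real.log (Q j / P j) else 0) =
        ∑ j, Q j * (h j - m - g j) - Real.log Z := by
      simp only [hQpos, if_true, hlog]
      simp only [mul_sub _ _ (Real.log Z), sum_sub_distrib, ← sum_mul, hQsum, one_mul]
    have hle := hQ Q (fun j => (hQpos j).le) hQsum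
    rw [hentropy, sum_mul_exponent Q hQsum] at hle
    exact (Real.log_nonpos_iff hZpos.le).mp (by linarith)
end

section
/- In the online convex aggregation setting with BOA weights driven by the linearized centered losses at fixed learning rate η > 0 (i.e. π_{j,t} = π_{j,t−1} exp(−η ℓ_{j,t}(1+η ℓ_{j,t})) / Σ_i π_{i,t−1} exp(−η ℓ_{i,t}(1+η ℓ_{i,t})) for 1 ≤ t ≤ n+1), if η ℓ_{j,t} ≤ 1/2 for all 1 ≤ j ≤ M and 1 ≤ t ≤ n+1, then Σ_{t=1}^{n+1} ℓ(y_t, ŷ_t) ≤ Σ_{t=1}^{n+1} ℓ(y_t, Σ_j π_j y_{j,t}) + η Σ_{t=1}^{n+1} Σ_j π_j ℓ_{j,t}² + K(π,π₀)/η for every probability vector π = (π_j)_{j=1}^M. -/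
open Finset

/-- The second order exponential inequality `exp (-x (1 + x)) ≤ 1 - x` on `(-∞, 1/2]`. -/
theorem exp_neg_mul_one_add_le {x : ℝ} (hx : x ≤ 1 / 2) :
    Real.exp (-x * (1 + x)) ≤ 1 - x := by
  rcases le_total 0 x with h0 | h0
  · have hquad := Real.quadratic_le_exp_of_nonneg (show 0 ≤ x * (1 + x) by positivity)
    have hpoly : 1 ≤ (1 - x) * (1 + x * (1 + x) + (x * (1 + x)) ^ 2 / 2) := by
      have hfactor : 0 ≤ 1 - x - x ^ 2 - x ^ 3 := by
        have h2 : x ^ 2 ≤ (1 / 2) ^ 2 := by gcongr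
        have h3 : x ^ 3 ≤ (1 / 2) ^ 3 := by gcongr
        linarith
      linear_combination x ^ 2 / 2 * hfactor
    rw [neg_mul, Real.exp_neg, inv_le_iff_one_le_mul₀ (Real.exp_pos _)]
    exact hpoly.trans (mul_le_mul_of_nonneg_left hquad (by linarith))
  · have hlog := Real.le_log_one_add_of_nonneg (neg_nonneg.2 h0)
    have hrat : -x * (1 + x) ≤ 2 * -x / (-x + 2) := by
      rw [le_div_iff₀ (by linarith)]
      nlinarith [mul_nonneg (sq_nonneg x) (show 0 ≤ 1 - x by linarith)]
    rw [sub_eq_add_neg, ← Real.le_log_iff_exp_le (by linarith)]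
    exact hrat.trans hlog

/-- Gibbs' inequality, relative to a third positive vector `r`. -/
theorem sum_mul_log_div_le_sum_mul_log_div {ι : Type*} [Fintype ι] {p q r : ι → ℝ}
    (hp : ∀ j, 0 < p j) (hr : ∀ j, 0 < r j) (hq : ∀ j, 0 ≤ q j)
    (hpq : ∑ j, p j ≤ ∑ j, q j) :
    ∑ j, q j * Real.log (p j / r j) ≤
      ∑ j, if 0 < q j then q j * Real.log (q j / r j) else 0 := by
  have hterm : ∀ j, q j * Real.log (p j / r j) ≤
      (if 0 < q j then q j * Real.log (q j / r j) else 0) + (p j - q j) := by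
    intro j
    split_ifs with h
    · have hlog := mul_le_mul_of_nonneg_left
        (Real.log_le_sub_one_of_pos (div_pos (hp j) h)) h.le
      rw [Real.log_div (hp j).ne' h.ne', mul_sub_one, mul_div_cancel₀ _ h.ne'] at hlog
      rw [Real.log_div (hp j).ne' (hr j).ne', Real.log_div h.ne' (hr j).ne']
      linarith
    · have h0 : q j = 0 := le_antisymm (not_lt.1 h) (hq j)
      simpa [h0] using (hp j).le
  calc ∑ j, q j * Real.log (p j / r j)
      ≤ ∑ j, ((if 0 < q j then q j * Real.log (q j / r j) else 0) + (p j - q j)) :=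
        Finset.sum_le_sum fun j _ => hterm j
    _ ≤ ∑ j, if 0 < q j then q j * Real.log (q j / r j) else 0 := by
        rw [Finset.sum_add_distrib, Finset.sum_sub_distrib]
        linarith

/-- The normalizing constant of a BOA update is at most one when the losses are centered. -/
theorem sum_mul_exp_neg_mul_one_add_le_one {ι : Type*} [Fintype ι] {p x : ι → ℝ}
    (hp : ∀ j, 0 ≤ p j) (hsum : ∑ j, p j = 1) (hcenter : ∑ j, p j * x j = 0)
    (hx : ∀ j, x j ≤ 1 / 2) :
    ∑ j, p j * Real.exp (-x j * (1 + x j)) ≤ 1 :=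
  calc ∑ j, p j * Real.exp (-x j * (1 + x j))
      ≤ ∑ j, p j * (1 - x j) := Finset.sum_le_sum fun j _ =>
        mul_le_mul_of_nonneg_left (exp_neg_mul_one_add_le (hx j)) (hp j)
    _ = 1 := by simp only [mul_sub, mul_one, Finset.sum_sub_distrib, hsum, hcenter, sub_zero]

/-- Along the BOA updates the weights remain positive and normalized, and the logarithm of each
weight decreases by at most the cumulative second order loss. -/
theorem boa_weights {ι : Type*} [Fintype ι] [Nonempty ι] {N : ℕ} {π x : ℕ → ι → ℝ}
    (hπ0pos : ∀ j, 0 < π 0 j) (hπ0sum : ∑ j, π 0 j = 1)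
    (hcenter : ∀ t < N, ∑ j, π t j = 1 → ∑ j, π t j * x (t + 1) j = 0)
    (hπ : ∀ t < N, ∀ j, π (t + 1) j = π t j * Real.exp (-x (t + 1) j * (1 + x (t + 1) j)) /
      ∑ i, π t i * Real.exp (-x (t + 1) i * (1 + x (t + 1) i)))
    (hx : ∀ t < N, ∀ j, x (t + 1) j ≤ 1 / 2) :
    ∀ t ≤ N, (∀ j, 0 < π t j) ∧ ∑ j, π t j = 1 ∧
      ∀ j, -∑ s ∈ Finset.Icc 1 t, x s j * (1 + x s j) ≤ Real.log (π t j / π 0 j) := by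
  intro t
  induction t with
  | zero => exact fun _ => ⟨hπ0pos, hπ0sum, fun j => by simp [(hπ0pos j).ne']⟩
  | succ t ih =>
    intro ht
    obtain ⟨hpos, hsum, hlog⟩ := ih (by lia)
    set W := ∑ i, π t i * Real.exp (-x (t + 1) i * (1 + x (t + 1) i)) with hW
    have hW0 : 0 < W := Finset.sum_pos
      (fun i _ => mul_pos (hpos i) (Real.exp_pos _)) Finset.univ_nonempty
    have hW1 : W ≤ 1 := sum_mul_exp_neg_mul_one_add_le_one (fun j => (hpos j).le) hsum
      (hcenter t ht hsum) (hx t ht)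
    refine ⟨fun j => ?_, ?_, fun j => ?_⟩
    · rw [hπ t ht j]
      exact div_pos (mul_pos (hpos j) (Real.exp_pos _)) hW0
    · rw [Finset.sum_congr rfl fun j _ => hπ t ht j, ← Finset.sum_div, ← hW, div_self hW0.ne']
    · have hj := hlog j
      have hlogW := Real.log_nonpos hW0.le hW1
      have hnum := mul_pos (hpos j) (Real.exp_pos (-x (t + 1) j * (1 + x (t + 1) j)))
      rw [Real.log_div (hpos j).ne' (hπ0pos j).ne'] at hj
      rw [hπ t ht j, ← hW, Real.log_div (div_pos hnum hW0).ne' (hπ0pos j).ne',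
        Real.log_div hnum.ne' hW0.ne', Real.log_mul (hpos j).ne' (Real.exp_pos _).ne',
        Real.log_exp, Finset.sum_Icc_succ_top (by lia)]
      linarith

/-- **Second order regret bound for convex BOA** (Theorem 2, second bound).
Online convex aggregation: outcomes `y t`, expert predictions `Yp j t`, a loss `loss`
convex in its second argument with subgradient `loss'`, aggregated prediction
`yhat t = ∑ⱼ π (t-1) j * Yp j t`, linearized centered losses
`ℓv j t = loss' (y t) (yhat t) * (Yp j t - yhat t)` and BOA weights at fixed rate `η`.
If `η * ℓv j t ≤ 1/2` for all `j`, `1 ≤ t ≤ n+1`, then for every probability vector `q`: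
`∑ₜ loss (y t) (yhat t) ≤ ∑ₜ loss (y t) (∑ⱼ qⱼ Yp j t) + η ∑ₜ ∑ⱼ qⱼ (ℓv j t)² + K(q,π 0)/η`. -/
theorem boa_convex_regret_bound (M n : ℕ) (hM : 0 < M) (η : ℝ) (hη : 0 < η)
    (loss loss' : ℝ → ℝ → ℝ)
    (hconv : ∀ y : ℝ, ConvexOn ℝ Set.univ (loss y))
    (hsub : ∀ y u v : ℝ, loss y u + loss' y u * (v - u) ≤ loss y v)
    (y : ℕ → ℝ) (Yp : Fin M → ℕ → ℝ)
    (π : ℕ → Fin M → ℝ) (yhat : ℕ → ℝ) (ℓv : Fin M → ℕ → ℝ)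
    (hπ0pos : ∀ j, 0 < π 0 j) (hπ0sum : ∑ j, π 0 j = 1)
    (hyhat : ∀ t ∈ Finset.Icc 1 (n + 1), yhat t = ∑ j, π (t - 1) j * Yp j t)
    (hℓv : ∀ j, ∀ t ∈ Finset.Icc 1 (n + 1),
      ℓv j t = loss' (y t) (yhat t) * (Yp j t - yhat t))
    (hπ : ∀ j, ∀ t ∈ Finset.Icc 1 (n + 1),
      π t j = π (t - 1) j * Real.exp (-η * ℓv j t * (1 + η * ℓv j t)) /
        ∑ i, π (t - 1) i * Real.exp (-η * ℓv i t * (1 + η * ℓv i t)))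
    (hbound : ∀ j, ∀ t ∈ Finset.Icc 1 (n + 1), η * ℓv j t ≤ 1 / 2)
    (q : Fin M → ℝ) (hq : ∀ j, 0 ≤ q j) (hqsum : ∑ j, q j = 1) :
    ∑ t ∈ Finset.Icc 1 (n + 1), loss (y t) (yhat t) ≤
      ∑ t ∈ Finset.Icc 1 (n + 1), loss (y t) (∑ j, q j * Yp j t)
        + η * ∑ t ∈ Finset.Icc 1 (n + 1), ∑ j, q j * (ℓv j t) ^ 2
        + (∑ j, if 0 < q j then q j * Real.log (q j / π 0 j) else 0) / η := by
  have : Nonempty (Fin M) := ⟨⟨0, hM⟩⟩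
  have hmem : ∀ t < n + 1, t + 1 ∈ Finset.Icc 1 (n + 1) := fun t ht => by
    rw [Finset.mem_Icc]; lia
  obtain ⟨hpos, hsum, hlog⟩ := boa_weights (N := n + 1) (π := π) (x := fun t j => η * ℓv j t)
    hπ0pos hπ0sum
    (fun t ht hsum => by
      have hy : yhat (t + 1) = ∑ j, π t j * Yp j (t + 1) := hyhat (t + 1) (hmem t ht)
      calc ∑ j, π t j * (η * ℓv j (t + 1))
          = ∑ j, η * loss' (y (t + 1)) (yhat (t + 1)) *
              (π t j * Yp j (t + 1) - π t j * yhat (t + 1)) :=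
            Finset.sum_congr rfl fun j _ => by rw [hℓv j (t + 1) (hmem t ht)]; ring
        _ = 0 := by
            rw [← Finset.mul_sum, Finset.sum_sub_distrib, ← Finset.sum_mul, hsum, ← hy]
            ring)
    (fun t ht j => by simpa using hπ j (t + 1) (hmem t ht))
    (fun t ht j => hbound j (t + 1) (hmem t ht)) (n + 1) le_rfl
  have hgibbs := sum_mul_log_div_le_sum_mul_log_div hpos hπ0pos hq (hsum.trans hqsum.symm).le
  have hcum : -∑ t ∈ Finset.Icc 1 (n + 1), ∑ j, q j * (η * ℓv j t * (1 + η * ℓv j t)) ≤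
      ∑ j, q j * Real.log (π (n + 1) j / π 0 j) := by
    rw [Finset.sum_comm, ← Finset.sum_neg_distrib]
    refine Finset.sum_le_sum fun j _ => ?_
    rw [← Finset.mul_sum, ← mul_neg]
    exact mul_le_mul_of_nonneg_left (hlog j) (hq j)
  have hsplit : ∑ t ∈ Finset.Icc 1 (n + 1), ∑ j, q j * (η * ℓv j t * (1 + η * ℓv j t)) =
      η * (∑ t ∈ Finset.Icc 1 (n + 1), ∑ j, q j * ℓv j t +
        η * ∑ t ∈ Finset.Icc 1 (n + 1), ∑ j, q j * (ℓv j t) ^ 2) := by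
    simp only [Finset.mul_sum, ← Finset.sum_add_distrib]
    exact Finset.sum_congr rfl fun t _ => Finset.sum_congr rfl fun j _ => by ring
  have hloss : ∑ t ∈ Finset.Icc 1 (n + 1), (loss (y t) (yhat t) + ∑ j, q j * ℓv j t) ≤
      ∑ t ∈ Finset.Icc 1 (n + 1), loss (y t) (∑ j, q j * Yp j t) := by
    refine Finset.sum_le_sum fun t ht => ?_
    have hlin : ∑ j, q j * ℓv j t =
        loss' (y t) (yhat t) * (∑ j, q j * Yp j t - yhat t) := by
      calc ∑ j, q j * ℓv j t
          = ∑ j, loss' (y t) (yhat t) * (q j * Yp j t - q j * yhat t) :=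
            Finset.sum_congr rfl fun j _ => by rw [hℓv j t ht]; ring
        _ = _ := by
            rw [← Finset.mul_sum, Finset.sum_sub_distrib, ← Finset.sum_mul, hqsum, one_mul]
    rw [hlin]
    exact hsub _ _ _
  rw [Finset.sum_add_distrib] at hloss
  rw [hsplit] at hcum
  have hdiv : -(∑ t ∈ Finset.Icc 1 (n + 1), ∑ j, q j * ℓv j t +
        η * ∑ t ∈ Finset.Icc 1 (n + 1), ∑ j, q j * (ℓv j t) ^ 2) ≤
      (∑ j, if 0 < q j then q j * Real.log (q j / π 0 j) else 0) / η := by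
    rw [le_div_iff₀ hη]
    linarith
  linarith
end

section
/- In the online convex aggregation setting with the adaptive BOA procedure, suppose |ℓ_{j,t}| ≤ E_j for all 1 ≤ t ≤ n+1 with known constants E_j > 0, that π_{j,0} < 1 for all j, and that the learning rates are tuned as η_{j,t} = min{ 1/(2E_j), √( log(π_{j,0}^{−1}) / Σ_{s=1}^t ℓ_{j,s}² ) } for 1 ≤ t ≤ n (with η_{j,0} = 1/(2E_j), and η_{j,t} = 1/(2E_j) when Σ_{s=1}^t ℓ_{j,s}² = 0). Then for every probability vector π = (π_j)_{j=1}^M: Σ_{t=1}^{n+1} ℓ(y_t, ŷ_t) ≤ Σ_{t=1}^{n+1} ℓ(y_t, Σ_j π_j y_{j,t}) + Σ_j π_j [ √(Σ_{t=1}^{n+1} ℓ_{j,t}²) · ( √(2 log(π_{j,0}^{−1}))/(√2 − 1) + B_n/√(log(π_{j,0}^{−1})) ) + E_j ( 2 log(π_{j,0}^{−1}) + 2B_n + 1 ) ], where B_n = log(1 + log(n)/2). -/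
open Finset

/-- The adaptive learning rate for range `E`, prior cost `lam` and cumulative square `v`. -/
noncomputable def boaRate (E lam v : ℝ) : ℝ :=
  if v = 0 then 1 / (2 * E) else min (1 / (2 * E)) (Real.sqrt (lam / v))

/-- The cumulative squared losses `∑_{s ≤ t} (ℓ s)²`. -/
noncomputable def cumSq (ℓ : ℕ → ℝ) (t : ℕ) : ℝ := ∑ s ∈ Finset.Icc 1 t, (ℓ s) ^ 2

lemma cumSq_zero (ℓ : ℕ → ℝ) : cumSq ℓ 0 = 0 := by simp [cumSq]

lemma cumSq_succ (ℓ : ℕ → ℝ) (t : ℕ) : cumSq ℓ (t + 1) = cumSq ℓ t + ℓ (t + 1) ^ 2 := by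
  simp [cumSq, Finset.sum_Icc_succ_top]

lemma cumSq_nonneg (ℓ : ℕ → ℝ) (t : ℕ) : 0 ≤ cumSq ℓ t :=
  Finset.sum_nonneg fun _ _ => sq_nonneg _

lemma cumSq_le_succ (ℓ : ℕ → ℝ) (t : ℕ) : cumSq ℓ t ≤ cumSq ℓ (t + 1) := by
  rw [cumSq_succ]; nlinarith [sq_nonneg (ℓ (t + 1))]

lemma cumSq_le {ℓ : ℕ → ℝ} {E : ℝ} {m : ℕ} (h : ∀ t ∈ Finset.Icc 1 m, |ℓ t| ≤ E) :
    cumSq ℓ m ≤ m * E ^ 2 := by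
  have : cumSq ℓ m ≤ ∑ _s ∈ Finset.Icc 1 m, E ^ 2 :=
    Finset.sum_le_sum fun t ht => by
      rw [← sq_abs]
      exact pow_le_pow_left₀ (abs_nonneg _) (h t ht) 2
  simpa using this

lemma sum_abs_le_sqrt_mul (ℓ : ℕ → ℝ) (m : ℕ) :
    ∑ t ∈ Finset.Icc 1 m, |ℓ t| ≤ Real.sqrt m * Real.sqrt (cumSq ℓ m) := by
  rw [← Real.sqrt_mul (by positivity)]
  apply Real.le_sqrt_of_sq_le
  have := sq_sum_le_card_mul_sum_sq (s := Finset.Icc 1 m) (f := fun t => |ℓ t|)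
  simpa [cumSq] using this

section Rate

variable {E lam v w : ℝ}

lemma boaRate_eq (hE : 0 < E) (hl : 0 < lam) (hv : 0 ≤ v) :
    boaRate E lam v = (max (2 * E) (Real.sqrt v / Real.sqrt lam))⁻¹ := by
  unfold boaRate
  split_ifs with h
  · subst h
    rw [Real.sqrt_zero, zero_div, max_eq_left (by positivity), one_div]
  · have hv' : 0 < v := lt_of_le_of_ne hv (Ne.symm h)
    have h1 : 0 < Real.sqrt v / Real.sqrt lam := by positivity
    rw [Real.sqrt_div' _ hv, one_div, ← inv_div (Real.sqrt v)]
    rcases le_total (2 * E) (Real.sqrt v / Real.sqrt lam) with h2 | h2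
    · rw [max_eq_right h2, min_eq_right (inv_anti₀ (by positivity) h2)]
    · rw [max_eq_left h2, min_eq_left (inv_anti₀ h1 h2)]

lemma boaRate_zero : boaRate E lam 0 = 1 / (2 * E) := by simp [boaRate]

lemma boaRate_pos (hE : 0 < E) (hl : 0 < lam) (hv : 0 ≤ v) : 0 < boaRate E lam v := by
  rw [boaRate_eq hE hl hv]
  exact inv_pos.2 (lt_max_of_lt_left (by positivity))

lemma boaRate_mul_le (hE : 0 < E) (hl : 0 < lam) (hv : 0 ≤ v) :
    boaRate E lam v * E ≤ 1 / 2 := by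
  rw [boaRate_eq hE hl hv, inv_mul_le_iff₀ (lt_max_of_lt_left (by positivity))]
  linarith [le_max_left (2 * E) (Real.sqrt v / Real.sqrt lam)]

lemma boaRate_mul_sqrt_le (hE : 0 < E) (hl : 0 < lam) (hv : 0 ≤ v) :
    boaRate E lam v * Real.sqrt v ≤ Real.sqrt lam := by
  rw [boaRate_eq hE hl hv, inv_mul_le_iff₀ (lt_max_of_lt_left (by positivity))]
  rw [← div_le_iff₀ (Real.sqrt_pos.2 hl)]
  exact le_max_right _ _

lemma boaRate_anti (hE : 0 < E) (hl : 0 < lam) (hv : 0 ≤ v) (hvw : v ≤ w) :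
    boaRate E lam w ≤ boaRate E lam v := by
  rw [boaRate_eq hE hl hv, boaRate_eq hE hl (hv.trans hvw)]
  apply inv_anti₀ (lt_max_of_lt_left (by positivity))
  gcongr

lemma inv_boaRate_le (hE : 0 < E) (hl : 0 < lam) (hv : 0 ≤ v) :
    (boaRate E lam v)⁻¹ ≤ 2 * E + Real.sqrt v / Real.sqrt lam := by
  rw [boaRate_eq hE hl hv, inv_inv]
  have : 0 ≤ Real.sqrt v / Real.sqrt lam := by positivity
  exact max_le (by linarith) (by linarith)

lemma log_boaRate_sub_le (hE : 0 < E) (hl : 0 < lam) (hv : 0 ≤ v) {x r : ℝ} (hx : 0 ≤ x)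
    (hvx : v ≤ x * E ^ 2) (hr : 2 ≤ r) (hxr : Real.sqrt x ≤ r * Real.sqrt lam) :
    Real.log (boaRate E lam 0) - Real.log (boaRate E lam v) ≤ Real.log (r / 2) := by
  have h0 := boaRate_pos hE hl le_rfl
  have h1 := boaRate_pos hE hl hv
  rw [← Real.log_div h0.ne' h1.ne']
  apply Real.log_le_log (by positivity)
  rw [boaRate_zero, boaRate_eq hE hl hv, div_inv_eq_mul]
  have h2 : max (2 * E) (Real.sqrt v / Real.sqrt lam) ≤ r * E := by
    apply max_le (by nlinarith)
    rw [div_le_iff₀ (Real.sqrt_pos.2 hl)]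
    calc Real.sqrt v ≤ Real.sqrt (x * E ^ 2) := Real.sqrt_le_sqrt hvx
      _ = Real.sqrt x * E := by rw [Real.sqrt_mul hx, Real.sqrt_sq hE.le]
      _ ≤ r * Real.sqrt lam * E := by gcongr
      _ = r * E * Real.sqrt lam := by ring
  calc 1 / (2 * E) * max (2 * E) (Real.sqrt v / Real.sqrt lam) ≤ 1 / (2 * E) * (r * E) := by gcongr
    _ = r / 2 := by field_simp

end Rate

section Exp

lemma exp_neg_quadratic_le {x : ℝ} (hx : |x| ≤ 1 / 2) :
    Real.exp (-(x * (1 + x))) ≤ 1 - x := by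
  obtain ⟨h1, h2⟩ := abs_le.1 hx
  rw [Real.exp_neg, inv_le_comm₀ (Real.exp_pos _) (by linarith)]
  rcases le_total 0 x with h | h
  · have h3 := Real.quadratic_le_exp_of_nonneg (x := x * (1 + x)) (by positivity)
    refine le_trans ?_ h3
    rw [inv_le_iff_one_le_mul₀ (by linarith)]
    nlinarith [mul_nonneg (sq_nonneg x) (show 0 ≤ 1 - x - x ^ 2 - x ^ 3 by
      nlinarith [mul_nonneg h (sub_nonneg.2 h2), mul_nonneg (sq_nonneg x) (sub_nonneg.2 h2)])]
  · have h3 := Real.add_one_le_exp (x * (1 + x))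
    refine le_trans ?_ h3
    rw [inv_le_iff_one_le_mul₀ (by linarith)]
    nlinarith [mul_nonneg (neg_nonneg.2 h) (sq_nonneg x)]

lemma mul_exp_neg_le (u : ℝ) : u * Real.exp (-u) ≤ 46 / 125 := by
  have h := Real.add_one_le_exp (u - 1)
  have he := Real.exp_one_gt_d9
  have h1 : u * Real.exp (-u) ≤ Real.exp (-1) := by
    calc u * Real.exp (-u) ≤ Real.exp (u - 1) * Real.exp (-u) := by gcongr; linarith
      _ = Real.exp (-1) := by rw [← Real.exp_add]; ring_nf
  refine h1.trans ?_
  rw [Real.exp_neg, inv_le_comm₀ (Real.exp_pos _) (by norm_num)]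
  norm_num at he ⊢; linarith

lemma log_le_mul_self {x : ℝ} (hx : 0 < x) : Real.log x ≤ 46 / 125 * x := by
  have h := mul_exp_neg_le (Real.log x)
  rw [Real.exp_neg, Real.exp_log hx, mul_inv_le_iff₀ hx] at h
  exact h

lemma exp_sub_exp_le_log {a b L : ℝ} (hb : 0 < b) (hab : b ≤ a) :
    Real.exp (-b * L) - Real.exp (-a * L) ≤ 46 / 125 * (Real.log a - Real.log b) := by
  have hmono : MonotoneOn (fun x => Real.exp (-x * L) + 46 / 125 * Real.log x) (Set.Ioi 0) := by
    have hd : ∀ x ∈ Set.Ioi (0 : ℝ), HasDerivAt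
        (fun x => Real.exp (-x * L) + 46 / 125 * Real.log x)
        (Real.exp (-x * L) * (-1 * L) + 46 / 125 * x⁻¹) x := fun x hx =>
      (((hasDerivAt_id x).neg.mul_const L).exp).add
        ((Real.hasDerivAt_log (ne_of_gt hx)).const_mul _)
    apply monotoneOn_of_deriv_nonneg (convex_Ioi 0)
    · exact fun x hx => (hd x hx).continuousAt.continuousWithinAt
    · intro x hx
      rw [interior_Ioi] at hx
      exact (hd x hx).differentiableAt.differentiableWithinAt
    · intro x hx
      rw [interior_Ioi] at hx
      rw [(hd x hx).deriv]
      have hx0 : 0 < x := hx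
      have h := mul_exp_neg_le (x * L)
      have h2 : L * Real.exp (-x * L) ≤ 46 / 125 * x⁻¹ := by
        rw [← div_eq_mul_inv, le_div_iff₀ hx0]
        rw [neg_mul]
        linarith
      linarith
  have := hmono (Set.mem_Ioi.2 hb) (Set.mem_Ioi.2 (hb.trans_le hab)) hab
  simp only at this
  linarith

lemma exp_sub_exp_le_of_le {a b L C d : ℝ} (hb : 0 < b) (hab : b ≤ a) (hC : 0 ≤ C) (hd : 0 ≤ d)
    (hL : a * L ≤ d + a * C) :
    Real.exp (-b * L) - Real.exp (-a * L) ≤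
      C * (a - b) + d * (Real.log a - Real.log b) := by
  have ha : 0 < a := hb.trans_le hab
  have hlog : 1 - b / a ≤ Real.log a - Real.log b := by
    have := Real.one_sub_inv_le_log_of_pos (x := a / b) (by positivity)
    rwa [inv_div, Real.log_div ha.ne' hb.ne'] at this
  have hba : b / a ≤ 1 := (div_le_one ha).2 hab
  rcases le_total L 0 with h | h
  · have : Real.exp (-b * L) ≤ Real.exp (-a * L) := by
      apply Real.exp_le_exp.2; nlinarith
    have h1 : 0 ≤ C * (a - b) := mul_nonneg hC (by linarith)
    have h2 : 0 ≤ d * (Real.log a - Real.log b) := mul_nonneg hd (by linarith)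
    linarith
  · have h1 := Real.add_one_le_exp (-((a - b) * L))
    have h2 : Real.exp (-a * L) = Real.exp (-b * L) * Real.exp (-((a - b) * L)) := by
      rw [← Real.exp_add]; ring_nf
    have h3 : Real.exp (-b * L) ≤ 1 := Real.exp_le_one_iff.2 (by nlinarith)
    have h4 : Real.exp (-b * L) - Real.exp (-a * L) ≤ (a - b) * L := by
      rw [h2]
      have h5 : 0 ≤ (a - b) * L := mul_nonneg (by linarith) h
      nlinarith [Real.exp_pos (-b * L)]
    have h6 : (a - b) * L = (1 - b / a) * (a * L) := by field_simp
    have h7 : (1 - b / a) * (a * L) ≤ (1 - b / a) * (d + a * C) :=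
      mul_le_mul_of_nonneg_left hL (by linarith)
    have h8 : (1 - b / a) * (d + a * C) = C * (a - b) + (1 - b / a) * d := by field_simp; ring
    nlinarith

end Exp

/-- One expert's centered losses `ℓ`, learning rates `η` and cumulative surrogate losses `L`
along a run of the adaptive BOA procedure over `n + 1` rounds. -/
structure IsBOATrack (ℓ η L : ℕ → ℝ) (E lam : ℝ) (n : ℕ) : Prop where
  range_pos : 0 < E
  cost_pos : 0 < lam
  rate : ∀ t ≤ n, η t = boaRate E lam (cumSq ℓ t)
  abs_bound : ∀ t ∈ Finset.Icc 1 (n + 1), |ℓ t| ≤ E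
  init : L 0 = 0
  step : ∀ t ≤ n, L (t + 1) = L t + ℓ (t + 1) * (1 + η t * ℓ (t + 1))

namespace IsBOATrack

variable {ℓ η L : ℕ → ℝ} {E lam : ℝ} {n : ℕ}

lemma rate_pos (h : IsBOATrack ℓ η L E lam n) {t : ℕ} (ht : t ≤ n) : 0 < η t := by
  rw [h.rate t ht]; exact boaRate_pos h.range_pos h.cost_pos (cumSq_nonneg _ _)

lemma rate_mul_le (h : IsBOATrack ℓ η L E lam n) {t : ℕ} (ht : t ≤ n) : η t * E ≤ 1 / 2 := by
  rw [h.rate t ht]; exact boaRate_mul_le h.range_pos h.cost_pos (cumSq_nonneg _ _)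

lemma rate_zero (h : IsBOATrack ℓ η L E lam n) : η 0 = 1 / (2 * E) := by
  rw [h.rate 0 (Nat.zero_le _), cumSq_zero, boaRate_zero]

lemma rate_mul_sqrt_le (h : IsBOATrack ℓ η L E lam n) {t : ℕ} (ht : t ≤ n) :
    η t * Real.sqrt (cumSq ℓ t) ≤ Real.sqrt lam := by
  rw [h.rate t ht]; exact boaRate_mul_sqrt_le h.range_pos h.cost_pos (cumSq_nonneg _ _)

lemma rate_succ_le (h : IsBOATrack ℓ η L E lam n) {t : ℕ} (ht : t + 1 ≤ n) :
    η (t + 1) ≤ η t := by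
  rw [h.rate t (by omega), h.rate (t + 1) ht]
  exact boaRate_anti h.range_pos h.cost_pos (cumSq_nonneg _ _) (cumSq_le_succ _ _)

lemma abs_loss_le (h : IsBOATrack ℓ η L E lam n) {t : ℕ} (ht : t ≤ n) : |ℓ (t + 1)| ≤ E :=
  h.abs_bound _ (by simp; omega)

lemma abs_rate_mul_loss_le (h : IsBOATrack ℓ η L E lam n) {t : ℕ} (ht : t ≤ n) :
    |η t * ℓ (t + 1)| ≤ 1 / 2 := by
  rw [abs_mul, abs_of_pos (h.rate_pos ht)]
  exact (mul_le_mul_of_nonneg_left (h.abs_loss_le ht) (h.rate_pos ht).le).trans (h.rate_mul_le ht)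

lemma increment_le (h : IsBOATrack ℓ η L E lam n) {t : ℕ} (ht : t ≤ n) :
    L (t + 1) - L t ≤ 3 / 2 * |ℓ (t + 1)| := by
  rw [h.step t ht]
  have h1 := _root_.abs_le.1 (h.abs_rate_mul_loss_le ht)
  have h2 : ℓ (t + 1) * (1 + η t * ℓ (t + 1)) ≤ |ℓ (t + 1)| * |1 + η t * ℓ (t + 1)| := by
    rw [← abs_mul]; exact le_abs_self _
  rw [abs_of_nonneg (a := 1 + η t * ℓ (t + 1)) (by linarith)] at h2
  nlinarith [abs_nonneg (ℓ (t + 1))]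

lemma le_sum_abs (h : IsBOATrack ℓ η L E lam n) {t : ℕ} (ht : t ≤ n) :
    L t ≤ 3 / 2 * ∑ s ∈ Finset.Icc 1 t, |ℓ s| := by
  induction t with
  | zero => simp [h.init]
  | succ t ih =>
    rw [Finset.sum_Icc_succ_top (by omega)]
    have := h.increment_le (t := t) (by omega)
    have := ih (by omega)
    linarith

lemma exp_step_le (h : IsBOATrack ℓ η L E lam n) {t : ℕ} (ht : t ≤ n) :
    Real.exp (-η t * L (t + 1)) ≤ Real.exp (-η t * L t) * (1 - η t * ℓ (t + 1)) := by
  rw [h.step t ht, show -η t * (L t + ℓ (t + 1) * (1 + η t * ℓ (t + 1))) =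
    -η t * L t + -(η t * ℓ (t + 1) * (1 + η t * ℓ (t + 1))) by ring, Real.exp_add]
  gcongr
  exact exp_neg_quadratic_le (h.abs_rate_mul_loss_le ht)

/-- The potential lost when the learning rate is decreased along the first `n` rounds. -/
noncomputable def rateLoss (η L : ℕ → ℝ) (n : ℕ) : ℝ :=
  ∑ t ∈ Finset.Icc 1 n, (Real.exp (-η t * L t) - Real.exp (-η (t - 1) * L t))

lemma rateLoss_succ (η L : ℕ → ℝ) (t : ℕ) : rateLoss η L (t + 1) =
    rateLoss η L t + (Real.exp (-η (t + 1) * L (t + 1)) - Real.exp (-η t * L (t + 1))) := by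
  rw [rateLoss, Finset.sum_Icc_succ_top (by omega), Nat.add_sub_cancel, rateLoss]

lemma rateLoss_le_log (h : IsBOATrack ℓ η L E lam n) :
    rateLoss η L n ≤ 46 / 125 * (Real.log (η 0) - Real.log (η n)) := by
  suffices ∀ t ≤ n, rateLoss η L t ≤ 46 / 125 * (Real.log (η 0) - Real.log (η t)) from
    this n le_rfl
  intro t ht
  induction t with
  | zero => simp [rateLoss]
  | succ t ih =>
    rw [rateLoss_succ]
    have := exp_sub_exp_le_log (L := L (t + 1)) (h.rate_pos ht) (h.rate_succ_le ht)
    have := ih (by omega)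
    linarith

lemma rate_mul_le_sqrt (h : IsBOATrack ℓ η L E lam n) {t : ℕ} (ht : t ≤ n) :
    η t * L t ≤ 3 / 2 * (Real.sqrt n * Real.sqrt lam) := by
  have h1 := h.le_sum_abs ht
  have h2 := sum_abs_le_sqrt_mul ℓ t
  have h3 := h.rate_mul_sqrt_le ht
  have h4 : Real.sqrt t ≤ Real.sqrt n := Real.sqrt_le_sqrt (by exact_mod_cast ht)
  have h5 := h.rate_pos ht
  calc η t * L t ≤ η t * (3 / 2 * (Real.sqrt t * Real.sqrt (cumSq ℓ t))) := by gcongr; linarith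
    _ = 3 / 2 * (Real.sqrt t * (η t * Real.sqrt (cumSq ℓ t))) := by ring
    _ ≤ _ := by gcongr

lemma rateLoss_le_sqrt (h : IsBOATrack ℓ η L E lam n) :
    rateLoss η L n ≤ 3 / 4 +
      3 / 2 * (Real.sqrt n * Real.sqrt lam) * (Real.log (η 0) - Real.log (η n)) := by
  suffices ∀ t ≤ n, rateLoss η L t ≤ 3 / 2 * E * (η 0 - η t) +
      3 / 2 * (Real.sqrt n * Real.sqrt lam) * (Real.log (η 0) - Real.log (η t)) by
    have h1 := this n le_rfl
    have h2 := h.rate_mul_le (Nat.zero_le n)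
    nlinarith [mul_pos h.range_pos (h.rate_pos le_rfl)]
  intro t ht
  induction t with
  | zero => simp [rateLoss]
  | succ t ih =>
    rw [rateLoss_succ]
    have h1 := h.rate_mul_le_sqrt (t := t) (by omega)
    have h2 := h.increment_le (t := t) (by omega)
    have h3 := h.abs_loss_le (t := t) (by omega)
    have h4 := h.rate_pos (t := t) (by omega)
    have h5 : η t * L (t + 1) ≤ 3 / 2 * (Real.sqrt n * Real.sqrt lam) + η t * (3 / 2 * E) := by
      nlinarith
    have h6 := exp_sub_exp_le_of_le (h.rate_pos ht) (h.rate_succ_le ht)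
      (by linarith [h.range_pos]) (by positivity) h5
    have := ih (by omega)
    linarith

lemma log_rate_sub_le (h : IsBOATrack ℓ η L E lam n) {r : ℝ} (hr : 2 ≤ r)
    (hnr : Real.sqrt n ≤ r * Real.sqrt lam) :
    Real.log (η 0) - Real.log (η n) ≤ Real.log (r / 2) := by
  rw [h.rate 0 (Nat.zero_le _), h.rate n le_rfl, cumSq_zero]
  exact log_boaRate_sub_le h.range_pos h.cost_pos (cumSq_nonneg _ _) (Nat.cast_nonneg n)
    (cumSq_le fun t ht => h.abs_bound t (by simp at ht ⊢; omega)) hr hnr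

/-- The rate-weighted sum of squares, with the rate of the previous round. -/
noncomputable def rateSq (η ℓ : ℕ → ℝ) (m : ℕ) : ℝ :=
  ∑ t ∈ Finset.Icc 1 m, η (t - 1) * ℓ t ^ 2

lemma rateSq_succ (η ℓ : ℕ → ℝ) (t : ℕ) :
    rateSq η ℓ (t + 1) = rateSq η ℓ t + η t * ℓ (t + 1) ^ 2 := by
  simp [rateSq, Finset.sum_Icc_succ_top]

lemma neg_sum_eq (h : IsBOATrack ℓ η L E lam n) :
    -∑ t ∈ Finset.Icc 1 (n + 1), ℓ t = -L (n + 1) + rateSq η ℓ (n + 1) := by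
  suffices ∀ t ≤ n + 1, -∑ s ∈ Finset.Icc 1 t, ℓ s = -L t + rateSq η ℓ t from this _ le_rfl
  intro t ht
  induction t with
  | zero => simp [rateSq, h.init]
  | succ t ih =>
    rw [rateSq_succ, Finset.sum_Icc_succ_top (by omega), h.step t (by omega)]
    have := ih (by omega)
    linarith

lemma rate_mul_sq_le (h : IsBOATrack ℓ η L E lam n) {t : ℕ} (ht : t ≤ n) {K : ℝ}
    (hK : η t * Real.sqrt (cumSq ℓ (t + 1)) ≤ K) :
    η t * ℓ (t + 1) ^ 2 ≤ (Real.sqrt lam + K) *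
      (Real.sqrt (cumSq ℓ (t + 1)) - Real.sqrt (cumSq ℓ t)) := by
  have h1 := h.rate_mul_sqrt_le ht
  have h2 : 0 ≤ Real.sqrt (cumSq ℓ (t + 1)) - Real.sqrt (cumSq ℓ t) :=
    sub_nonneg.2 (Real.sqrt_le_sqrt (cumSq_le_succ _ _))
  have h3 : ℓ (t + 1) ^ 2 = Real.sqrt (cumSq ℓ (t + 1)) ^ 2 - Real.sqrt (cumSq ℓ t) ^ 2 := by
    rw [Real.sq_sqrt (cumSq_nonneg _ _), Real.sq_sqrt (cumSq_nonneg _ _), cumSq_succ]; ring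
  calc η t * ℓ (t + 1) ^ 2 = (η t * Real.sqrt (cumSq ℓ t) + η t * Real.sqrt (cumSq ℓ (t + 1))) *
        (Real.sqrt (cumSq ℓ (t + 1)) - Real.sqrt (cumSq ℓ t)) := by rw [h3]; ring
    _ ≤ _ := by gcongr

lemma rateSq_le_sqrt (h : IsBOATrack ℓ η L E lam n) :
    rateSq η ℓ (n + 1) ≤
      (Real.sqrt lam + Real.sqrt (lam + 1 / 4)) * Real.sqrt (cumSq ℓ (n + 1)) := by
  suffices ∀ t ≤ n + 1, rateSq η ℓ t ≤
      (Real.sqrt lam + Real.sqrt (lam + 1 / 4)) * Real.sqrt (cumSq ℓ t) from this _ le_rfl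
  intro t ht
  induction t with
  | zero => simp [rateSq, cumSq_zero]
  | succ t ih =>
    have htn : t ≤ n := by omega
    have hp := h.rate_pos htn
    have hK : η t * Real.sqrt (cumSq ℓ (t + 1)) ≤ Real.sqrt (lam + 1 / 4) := by
      apply Real.le_sqrt_of_sq_le
      rw [mul_pow, Real.sq_sqrt (cumSq_nonneg _ _), cumSq_succ, mul_add]
      have h1 : η t ^ 2 * cumSq ℓ t ≤ lam := by
        have := pow_le_pow_left₀ (by positivity) (h.rate_mul_sqrt_le htn) 2
        rwa [mul_pow, Real.sq_sqrt (cumSq_nonneg _ _), Real.sq_sqrt h.cost_pos.le] at this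
      have h2 := pow_le_pow_left₀ (abs_nonneg _) (h.abs_rate_mul_loss_le htn) 2
      rw [sq_abs, mul_pow] at h2
      linarith
    have h3 := h.rate_mul_sq_le htn hK
    rw [rateSq_succ]
    have := ih (by omega)
    linarith

lemma rateSq_le_add_sqrt (h : IsBOATrack ℓ η L E lam n) :
    rateSq η ℓ (n + 1) ≤
      E + (1 + Real.sqrt 2) * Real.sqrt lam * Real.sqrt (cumSq ℓ (n + 1)) := by
  have hE := h.range_pos
  suffices ∀ t ≤ n + 1, E * rateSq η ℓ t ≤ cumSq ℓ t / 2 ∧ rateSq η ℓ t ≤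
      E + (1 + Real.sqrt 2) * Real.sqrt lam * Real.sqrt (cumSq ℓ t) from (this _ le_rfl).2
  intro t ht
  induction t with
  | zero => simp [rateSq, cumSq_zero, hE.le]
  | succ t ih =>
    have htn : t ≤ n := by omega
    have hp := h.rate_pos htn
    obtain ⟨ih1, ih2⟩ := ih (by omega)
    have ha : ℓ (t + 1) ^ 2 ≤ E ^ 2 := by
      rw [← sq_abs]; exact pow_le_pow_left₀ (abs_nonneg _) (h.abs_loss_le htn) 2
    have hfirst : E * rateSq η ℓ (t + 1) ≤ cumSq ℓ (t + 1) / 2 := by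
      rw [rateSq_succ, cumSq_succ]
      nlinarith [mul_le_mul_of_nonneg_right (h.rate_mul_le htn) (sq_nonneg (ℓ (t + 1)))]
    refine ⟨hfirst, ?_⟩
    rcases le_total (E ^ 2) (cumSq ℓ t) with hc | hc
    · have hK : η t * Real.sqrt (cumSq ℓ (t + 1)) ≤ Real.sqrt 2 * Real.sqrt lam := by
        calc η t * Real.sqrt (cumSq ℓ (t + 1)) ≤ η t * Real.sqrt (2 * cumSq ℓ t) := by
              gcongr; rw [cumSq_succ]; linarith
          _ = Real.sqrt 2 * (η t * Real.sqrt (cumSq ℓ t)) := by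
              rw [Real.sqrt_mul (by norm_num)]; ring
          _ ≤ _ := by gcongr; exact h.rate_mul_sqrt_le htn
      have h3 := h.rate_mul_sq_le htn hK
      rw [rateSq_succ]
      linarith
    · have h1 : E * rateSq η ℓ (t + 1) ≤ E * E := by
        rw [cumSq_succ] at hfirst; nlinarith
      have h2 := le_of_mul_le_mul_left h1 hE
      have h3 : 0 ≤ (1 + Real.sqrt 2) * Real.sqrt lam * Real.sqrt (cumSq ℓ (t + 1)) := by
        positivity
      linarith

lemma neg_sum_le_of_exp_le (h : IsBOATrack ℓ η L E lam n) {b : ℝ} (hb : 0 ≤ b)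
    (hS : Real.exp (-lam) * Real.exp (-η n * L (n + 1)) ≤ Real.exp b) :
    -∑ t ∈ Finset.Icc 1 (n + 1), ℓ t ≤ rateSq η ℓ (n + 1) +
      (2 * E + Real.sqrt (cumSq ℓ (n + 1)) / Real.sqrt lam) * (lam + b) := by
  rw [h.neg_sum_eq]
  rw [← Real.exp_add, Real.exp_le_exp] at hS
  have hp := h.rate_pos le_rfl
  have hl := h.cost_pos
  have h1 : -L (n + 1) ≤ (η n)⁻¹ * (lam + b) := by
    rw [le_inv_mul_iff₀ hp]; linarith
  have h2 : (η n)⁻¹ ≤ 2 * E + Real.sqrt (cumSq ℓ (n + 1)) / Real.sqrt lam := by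
    rw [h.rate n le_rfl]
    refine (inv_boaRate_le h.range_pos hl (cumSq_nonneg _ _)).trans ?_
    gcongr
    exact cumSq_le_succ _ _
  have h3 : (η n)⁻¹ * (lam + b) ≤
      (2 * E + Real.sqrt (cumSq ℓ (n + 1)) / Real.sqrt lam) * (lam + b) := by
    gcongr
  linarith

lemma neg_sum_le_sqrt_mul (ℓ : ℕ → ℝ) (m : ℕ) :
    -∑ t ∈ Finset.Icc 1 m, ℓ t ≤ Real.sqrt m * Real.sqrt (cumSq ℓ m) := by
  refine le_trans ?_ (sum_abs_le_sqrt_mul ℓ m)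
  rw [← Finset.sum_neg_distrib]
  exact Finset.sum_le_sum fun t _ => neg_le_abs _

end IsBOATrack

section Numeric

/-- The price `Bₙ = log (1 + log n / 2)` of adaptivity. -/
noncomputable def adaptCost (n : ℕ) : ℝ := Real.log (1 + Real.log n / 2)

lemma log_natCast_nonneg (n : ℕ) : 0 ≤ Real.log n := Real.log_natCast_nonneg n

lemma adaptCost_nonneg (n : ℕ) : 0 ≤ adaptCost n :=
  Real.log_nonneg (by linarith [log_natCast_nonneg n])

lemma exp_adaptCost (n : ℕ) : Real.exp (adaptCost n) = 1 + Real.log n / 2 :=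
  Real.exp_log (by linarith [log_natCast_nonneg n])

lemma mul_log_two_le_log {n k : ℕ} (h : 2 ^ k ≤ n) : k * (0.693 : ℝ) ≤ Real.log n := by
  have h1 : Real.log ((2 : ℝ) ^ k) ≤ Real.log n :=
    Real.log_le_log (by positivity) (by exact_mod_cast h)
  rw [Real.log_pow] at h1
  have := Real.log_two_gt_d9
  refine le_trans ?_ h1
  gcongr
  linarith

lemma le_adaptCost_small {n : ℕ} {x : ℝ} (hx : 0 ≤ x) (h : x ≤ Real.log n / 2) :
    2 * x / (x + 2) ≤ adaptCost n :=
  (Real.le_log_one_add_of_nonneg hx).trans (Real.log_le_log (by linarith) (by linarith))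

lemma le_adaptCost_large {n : ℕ} {x : ℝ} (hx : 0 ≤ x) (h : 1 + 2 * x ≤ Real.log n / 2) :
    0.693 + 2 * x / (x + 2) ≤ adaptCost n := by
  have h1 := Real.le_log_one_add_of_nonneg hx
  have h2 : Real.log (2 * (1 + x)) ≤ adaptCost n := Real.log_le_log (by linarith) (by linarith)
  rw [Real.log_mul (by norm_num) (by linarith)] at h2
  have := Real.log_two_gt_d9
  linarith

lemma sqrt_succ_le_of_le_seven {n : ℕ} (h2 : 2 ≤ n) (h7 : n ≤ 7) {s : ℝ} (hs : 0 < s) :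
    Real.sqrt (n + 1) ≤ (2 + Real.sqrt 2) * s + adaptCost n / s +
      (2 * adaptCost n + 1) / Real.sqrt (n + 1) := by
  have hc : 3.414 ≤ 2 + Real.sqrt 2 := by
    have : 1.414 ≤ Real.sqrt 2 := Real.le_sqrt_of_sq_le (by norm_num)
    linarith
  have hB := adaptCost_nonneg n
  have hn : (2 : ℝ) ≤ n := by exact_mod_cast h2
  set R := Real.sqrt ((n : ℝ) + 1) with hR
  have hR2 : R ^ 2 = n + 1 := Real.sq_sqrt (by positivity)
  have hR0 : 0 < R := Real.sqrt_pos.2 (by positivity)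
  have hX : 0 ≤ (2 + Real.sqrt 2) * s + adaptCost n / s := by positivity
  have hX2 : 4 * 3.414 * adaptCost n ≤ ((2 + Real.sqrt 2) * s + adaptCost n / s) ^ 2 := by
    have h : ((2 + Real.sqrt 2) * s + adaptCost n / s) ^ 2 =
        ((2 + Real.sqrt 2) * s - adaptCost n / s) ^ 2 + 4 * (2 + Real.sqrt 2) * adaptCost n := by
      field_simp; ring
    rw [h]
    nlinarith [sq_nonneg ((2 + Real.sqrt 2) * s - adaptCost n / s)]
  have hinv : (R⁻¹) ^ 2 ≤ 1 / 3 := by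
    rw [inv_pow, hR2, ← one_div]
    exact one_div_le_one_div_of_le (by norm_num) (by linarith)
  have hsq : (R - R⁻¹) ^ 2 ≤ 4 * 3.414 * adaptCost n := by
    have h : (R - R⁻¹) ^ 2 = R ^ 2 - 2 + R⁻¹ ^ 2 := by field_simp; ring
    rw [h, hR2]
    rcases Nat.lt_or_ge n 4 with h4 | h4
    · have h3 : (n : ℝ) ≤ 3 := by exact_mod_cast Nat.le_of_lt_succ h4
      have hl := mul_log_two_le_log (n := n) (k := 1) (by omega)
      have := le_adaptCost_small (n := n) (x := 0.3465) (by norm_num)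
        (by norm_num at hl ⊢; linarith)
      norm_num at this
      linarith
    · have h3 : (n : ℝ) ≤ 7 := by exact_mod_cast h7
      have h5 : (R⁻¹) ^ 2 ≤ 1 / 5 := by
        rw [inv_pow, hR2, ← one_div]
        have : (4 : ℝ) ≤ n := by exact_mod_cast h4
        exact one_div_le_one_div_of_le (by norm_num) (by linarith)
      have hl := mul_log_two_le_log (n := n) (k := 2) (by omega)
      have := le_adaptCost_small (n := n) (x := 0.693) (by norm_num)
        (by norm_num at hl ⊢; linarith)
      norm_num at this
      linarith
  have hfin := abs_le_of_sq_le_sq (hsq.trans hX2) hX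
  have hlast : R⁻¹ ≤ (2 * adaptCost n + 1) / R := by
    rw [← one_div]; gcongr; linarith
  linarith [(le_abs_self _).trans hfin]

lemma sqrt_succ_le_of_sq_le {n : ℕ} (h8 : 8 ≤ n) {s : ℝ} (hs : 0 < s) (hsn : s ^ 2 ≤ 1 / n) :
    Real.sqrt (n + 1) ≤ (2 + Real.sqrt 2) * s + adaptCost n / s +
      (2 * adaptCost n + 1) / Real.sqrt (n + 1) := by
  have hc : 3.414 ≤ 2 + Real.sqrt 2 := by
    have : 1.414 ≤ Real.sqrt 2 := Real.le_sqrt_of_sq_le (by norm_num)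
    linarith
  have hn : (8 : ℝ) ≤ n := by exact_mod_cast h8
  set R := Real.sqrt ((n : ℝ) + 1) with hR
  have hR2 : R ^ 2 = n + 1 := Real.sq_sqrt (by positivity)
  have hR0 : 0 < R := Real.sqrt_pos.2 (by positivity)
  obtain ⟨u, hu⟩ : ∃ u, u = s * R := ⟨_, rfl⟩
  have hu0 : 0 < u := hu ▸ mul_pos hs hR0
  have hu2 : u ^ 2 = s ^ 2 * (n + 1) := by rw [hu, mul_pow, hR2]
  have hsn' : s ^ 2 * n ≤ 1 := by rwa [le_div_iff₀ (by linarith)] at hsn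
  have hun : u * n ≤ n + 1 / 2 := by
    have h1 : (u * n) ^ 2 ≤ (n + 1 / 2) ^ 2 := by
      rw [mul_pow, hu2]; nlinarith
    exact (le_abs_self _).trans (abs_le_of_sq_le_sq h1 (by linarith))
  have key : u * (n + 1) ≤ 3.414 * (2 * u - 1) + adaptCost n * (n + 1)
      + (2 * adaptCost n + 1) * u := by
    rcases Nat.lt_or_ge n 16 with h16 | h16
    · have hl := mul_log_two_le_log (n := n) (k := 3) (by omega)
      have hB := le_adaptCost_large (n := n) (x := 0.0197) (by norm_num)
        (by norm_num at hl ⊢; linarith)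
      have hB' : 0.712 ≤ adaptCost n := le_trans (by norm_num) hB
      have h3 : (n : ℝ) ≤ 15 := by exact_mod_cast Nat.le_of_lt_succ h16
      have hu1 : u ≤ 17 / 16 := by nlinarith
      have h5 : 0.712 * (n + 1 + 2 * u) ≤ adaptCost n * (n + 1 + 2 * u) := by gcongr
      norm_num at h5 ⊢
      nlinarith
    · rcases Nat.lt_or_ge n 32 with h32 | h32
      · have hl := mul_log_two_le_log (n := n) (k := 4) (by omega)
        have hB := le_adaptCost_large (n := n) (x := 0.193) (by norm_num)
          (by norm_num at hl ⊢; linarith)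
        have hB' : 0.868 ≤ adaptCost n := le_trans (by norm_num) hB
        have h3 : (n : ℝ) ≤ 31 := by exact_mod_cast Nat.le_of_lt_succ h32
        have h4 : (16 : ℝ) ≤ n := by exact_mod_cast h16
        have hu1 : u ≤ 33 / 32 := by nlinarith
        have h5 : 0.868 * (n + 1 + 2 * u) ≤ adaptCost n * (n + 1 + 2 * u) := by gcongr
        norm_num at h5 ⊢
        nlinarith
      · have hl := mul_log_two_le_log (n := n) (k := 5) (by omega)
        have hB := le_adaptCost_large (n := n) (x := 0.366) (by norm_num)
          (by norm_num at hl ⊢; linarith)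
        have hB' : 1 ≤ adaptCost n := le_trans (by norm_num) hB
        have h4 : (32 : ℝ) ≤ n := by exact_mod_cast h32
        have h5 : 1 * (n + 1 + 2 * u) ≤ adaptCost n * (n + 1 + 2 * u) := by gcongr
        have hu1 : u ≤ 2 := by nlinarith
        norm_num at h5 ⊢
        nlinarith
  have key2 : u * (n + 1) ≤ (2 + Real.sqrt 2) * u ^ 2 + adaptCost n * (n + 1)
      + (2 * adaptCost n + 1) * u := by
    have h1 : 3.414 * (2 * u - 1) ≤ 3.414 * u ^ 2 := by
      norm_num; nlinarith [sq_nonneg (u - 1)]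
    have h2 : 3.414 * u ^ 2 ≤ (2 + Real.sqrt 2) * u ^ 2 := by gcongr
    linarith
  have hfac : (2 + Real.sqrt 2) * s + adaptCost n / s + (2 * adaptCost n + 1) / R - R =
      ((2 + Real.sqrt 2) * u ^ 2 + adaptCost n * (n + 1) + (2 * adaptCost n + 1) * u
        - u * (n + 1)) / (s * (n + 1)) := by
    rw [← hR2, hu]
    field_simp
  have : 0 ≤ (2 + Real.sqrt 2) * s + adaptCost n / s + (2 * adaptCost n + 1) / R - R := by
    rw [hfac]
    exact div_nonneg (by linarith) (by positivity)
  linarith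

end Numeric

/-- The second order regret bound against one expert. -/
noncomputable def regretBound (E lam v : ℝ) (n : ℕ) : ℝ :=
  Real.sqrt v * (Real.sqrt (2 * lam) / (Real.sqrt 2 - 1) + adaptCost n / Real.sqrt lam)
    + E * (2 * lam + 2 * adaptCost n + 1)

lemma regretBound_eq (E lam v : ℝ) (n : ℕ) : regretBound E lam v n =
    Real.sqrt v * ((2 + Real.sqrt 2) * Real.sqrt lam + adaptCost n / Real.sqrt lam)
    + E * (2 * lam + 2 * adaptCost n + 1) := by
  have h : Real.sqrt 2 * Real.sqrt 2 = 2 := Real.mul_self_sqrt (by norm_num)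
  have h1 : 1 < Real.sqrt 2 := by nlinarith [Real.sqrt_nonneg 2]
  rw [regretBound, Real.sqrt_mul (by norm_num)]
  congr 3
  rw [div_eq_iff (by linarith)]
  linear_combination (-Real.sqrt lam) * h

namespace IsBOATrack

variable {ℓ η L : ℕ → ℝ} {E lam : ℝ} {n : ℕ}

lemma rateLoss_le_of_le_cost (h : IsBOATrack ℓ η L E lam n) (hn : 8 ≤ n) (hl : 1 / n ≤ lam) :
    rateLoss η L n ≤ Real.log n / 2 - 1 / 2 := by
  have hn' : (8 : ℝ) ≤ n := by exact_mod_cast hn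
  have h1 : Real.sqrt n ≤ n * Real.sqrt lam := by
    rw [Real.sqrt_le_iff]
    refine ⟨by positivity, ?_⟩
    rw [mul_pow, Real.sq_sqrt h.cost_pos.le]
    rw [div_le_iff₀ (by linarith)] at hl
    nlinarith
  have h2 := h.log_rate_sub_le (by linarith) h1
  rw [Real.log_div (by linarith) (by norm_num)] at h2
  have h3 := h.rateLoss_le_log
  have h4 := mul_log_two_le_log (n := n) (k := 3) (by omega)
  have := Real.log_two_gt_d9
  norm_num at h4
  linarith

lemma rateLoss_le (h : IsBOATrack ℓ η L E lam n) (hn : 8 ≤ n) :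
    rateLoss η L n ≤ 4 / 5 * Real.log n := by
  have hn' : (8 : ℝ) ≤ n := by exact_mod_cast hn
  have hlog := mul_log_two_le_log (n := n) (k := 3) (by omega)
  norm_num at hlog
  have hs := Real.sqrt_pos.2 h.cost_pos
  rcases le_total (Real.sqrt n) (n ^ 2 * Real.sqrt lam) with hc | hc
  · have h2 := h.log_rate_sub_le (by nlinarith) hc
    rw [Real.log_div (by positivity) (by norm_num), Real.log_pow] at h2
    have h3 := h.rateLoss_le_log
    have := Real.log_two_gt_d9
    push_cast at h2
    linarith
  · set w := Real.sqrt (Real.sqrt n / Real.sqrt lam / 2) with hw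
    have hr : (n : ℝ) ^ 2 ≤ Real.sqrt n / Real.sqrt lam := by rwa [le_div_iff₀ hs]
    have hw2 : w ^ 2 = Real.sqrt n / Real.sqrt lam / 2 := Real.sq_sqrt (by positivity)
    have hw0 : 0 < w := Real.sqrt_pos.2 (by nlinarith)
    have h2 := h.log_rate_sub_le (r := Real.sqrt n / Real.sqrt lam) (by nlinarith)
      (by rw [div_mul_cancel₀ _ hs.ne'])
    rw [← hw2, Real.log_pow] at h2
    have h4 := log_le_mul_self hw0
    have h5 : Real.sqrt n * Real.sqrt lam * (2 * w ^ 2) = n := by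
      rw [hw2]
      field_simp
      exact Real.sq_sqrt (by positivity)
    have h6 : (n : ℝ) ≤ 3 / 2 * w := by nlinarith
    have h7 : Real.sqrt n * Real.sqrt lam * w ≤ 3 / 4 := by nlinarith
    have h3 := h.rateLoss_le_sqrt
    have h8 : 3 / 2 * (Real.sqrt n * Real.sqrt lam) * (Real.log (η 0) - Real.log (η n)) ≤
        3 / 2 * (Real.sqrt n * Real.sqrt lam) * (92 / 125 * w) := by
      gcongr
      push_cast at h2
      linarith
    linarith

lemma neg_sum_le_regretBound_of_sqrt_le (h : IsBOATrack ℓ η L E lam n)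
    (hs : Real.sqrt (n + 1) ≤ (2 + Real.sqrt 2) * Real.sqrt lam + adaptCost n / Real.sqrt lam +
      (2 * adaptCost n + 1) / Real.sqrt (n + 1)) :
    -∑ t ∈ Finset.Icc 1 (n + 1), ℓ t ≤ regretBound E lam (cumSq ℓ (n + 1)) n := by
  have hB := adaptCost_nonneg n
  have hE := h.range_pos
  have hl := h.cost_pos
  have hn : 0 < Real.sqrt ((n : ℝ) + 1) := Real.sqrt_pos.2 (by positivity)
  rw [regretBound_eq]
  have h1 := neg_sum_le_sqrt_mul ℓ (n + 1)
  have h2 : Real.sqrt (cumSq ℓ (n + 1)) ≤ Real.sqrt (n + 1) * E := by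
    rw [Real.sqrt_le_iff, mul_pow, Real.sq_sqrt (by positivity)]
    refine ⟨by positivity, ?_⟩
    have := cumSq_le h.abs_bound
    push_cast at this
    exact this
  push_cast at h1
  have h3 := mul_le_mul_of_nonneg_right hs (Real.sqrt_nonneg (cumSq ℓ (n + 1)))
  have h4 : (2 * adaptCost n + 1) / Real.sqrt (n + 1) * Real.sqrt (cumSq ℓ (n + 1)) ≤
      (2 * adaptCost n + 1) * E := by
    rw [div_mul_eq_mul_div, div_le_iff₀ hn]
    nlinarith
  nlinarith [mul_pos hE hl]

lemma neg_sum_le_regretBound_of_exp_le (h : IsBOATrack ℓ η L E lam n)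
    (hS : Real.exp (-lam) * Real.exp (-η n * L (n + 1)) ≤ 1 + Real.log n / 2) :
    -∑ t ∈ Finset.Icc 1 (n + 1), ℓ t ≤ regretBound E lam (cumSq ℓ (n + 1)) n := by
  rw [← exp_adaptCost] at hS
  have h1 := h.neg_sum_le_of_exp_le (adaptCost_nonneg n) hS
  have h2 := h.rateSq_le_add_sqrt
  have hs := Real.sqrt_pos.2 h.cost_pos
  have h3 : Real.sqrt (cumSq ℓ (n + 1)) / Real.sqrt lam * lam =
      Real.sqrt (cumSq ℓ (n + 1)) * Real.sqrt lam := by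
    rw [div_mul_eq_mul_div, div_eq_iff hs.ne', mul_assoc, Real.mul_self_sqrt h.cost_pos.le]
  rw [regretBound_eq]
  have h4 : Real.sqrt (cumSq ℓ (n + 1)) * (adaptCost n / Real.sqrt lam) =
    Real.sqrt (cumSq ℓ (n + 1)) / Real.sqrt lam * adaptCost n := by ring
  linear_combination h1 + h2 + h3 - h4

lemma neg_sum_le_regretBound_of_exp_le_of_two_le (h : IsBOATrack ℓ η L E lam n) (hl2 : 2 ≤ lam)
    (hS : Real.exp (-lam) * Real.exp (-η n * L (n + 1)) ≤
      Real.exp (1 / 2) * (1 + Real.log n / 2)) :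
    -∑ t ∈ Finset.Icc 1 (n + 1), ℓ t ≤ regretBound E lam (cumSq ℓ (n + 1)) n := by
  rw [← exp_adaptCost, ← Real.exp_add (1 / 2)] at hS
  have h1 := h.neg_sum_le_of_exp_le (by linarith [adaptCost_nonneg n]) hS
  have h2 := h.rateSq_le_sqrt
  have hs := Real.sqrt_pos.2 h.cost_pos
  have hss := Real.sq_sqrt h.cost_pos.le
  have h3 : Real.sqrt (cumSq ℓ (n + 1)) / Real.sqrt lam * lam =
      Real.sqrt (cumSq ℓ (n + 1)) * Real.sqrt lam := by
    rw [div_mul_eq_mul_div, div_eq_iff hs.ne', mul_assoc, Real.mul_self_sqrt h.cost_pos.le]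
  rw [regretBound_eq]
  have h4 : Real.sqrt (cumSq ℓ (n + 1)) * (adaptCost n / Real.sqrt lam) =
    Real.sqrt (cumSq ℓ (n + 1)) / Real.sqrt lam * adaptCost n := by ring
  have h5 : Real.sqrt (lam + 1 / 4) ≤ 17 / 16 * Real.sqrt lam := by
    rw [Real.sqrt_le_iff]
    exact ⟨by positivity, by nlinarith⟩
  have h6 : 1.4 ≤ Real.sqrt 2 := Real.le_sqrt_of_sq_le (by norm_num)
  have h7 : Real.sqrt (cumSq ℓ (n + 1)) / Real.sqrt lam ≤
      Real.sqrt (cumSq ℓ (n + 1)) * Real.sqrt lam / 2 := by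
    rw [div_le_iff₀ hs]
    nlinarith [Real.sqrt_nonneg (cumSq ℓ (n + 1))]
  have h8 : (Real.sqrt lam + Real.sqrt (lam + 1 / 4)) * Real.sqrt (cumSq ℓ (n + 1)) ≤
      (33 / 16 * Real.sqrt lam) * Real.sqrt (cumSq ℓ (n + 1)) := by
    gcongr; linarith
  have h9 : 1.4 * (Real.sqrt lam * Real.sqrt (cumSq ℓ (n + 1))) ≤
      Real.sqrt 2 * (Real.sqrt lam * Real.sqrt (cumSq ℓ (n + 1))) := by gcongr
  have h10 : 0 ≤ Real.sqrt lam * Real.sqrt (cumSq ℓ (n + 1)) := by positivity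
  have h11 := h.range_pos
  norm_num at h9
  linear_combination h1 + h2 + h3 - h4 + h8 + h9 + 1/2 * h7 + (7/80) * h10

end IsBOATrack

section Experts

open IsBOATrack

variable {ι : Type*} [Fintype ι] {p : ι → ℝ} {ℓ η L : ι → ℕ → ℝ} {E : ι → ℝ} {n : ℕ}

lemma sum_exp_le (hp : ∀ i, 0 < p i) (hp1 : ∑ i, p i = 1)
    (h : ∀ i, IsBOATrack (ℓ i) (η i) (L i) (E i) (Real.log (p i)⁻¹) n)
    (hbal : ∀ t, 1 ≤ t → t ≤ n →
      ∑ i, η i t * Real.exp (-η i t * L i t) * p i * ℓ i (t + 1) = 0) (hn : 1 ≤ n) :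
    ∑ i, p i * Real.exp (-η i n * L i (n + 1)) ≤ 3 / 2 + ∑ i, p i * rateLoss (η i) (L i) n := by
  have hstep : ∀ t, 1 ≤ t → t ≤ n → ∑ i, p i * Real.exp (-η i t * L i (t + 1)) ≤
      ∑ i, p i * Real.exp (-η i t * L i t) := by
    intro t h1 ht
    calc ∑ i, p i * Real.exp (-η i t * L i (t + 1))
        ≤ ∑ i, p i * (Real.exp (-η i t * L i t) * (1 - η i t * ℓ i (t + 1))) :=
          Finset.sum_le_sum fun i _ =>
            mul_le_mul_of_nonneg_left ((h i).exp_step_le ht) (hp i).le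
      _ = ∑ i, p i * Real.exp (-η i t * L i t) -
          ∑ i, η i t * Real.exp (-η i t * L i t) * p i * ℓ i (t + 1) := by
          rw [← Finset.sum_sub_distrib]
          exact Finset.sum_congr rfl fun i _ => by ring
      _ = _ := by rw [hbal t h1 ht, sub_zero]
  have hfirst : ∑ i, p i * Real.exp (-η i 0 * L i (0 + 1)) ≤ 3 / 2 := by
    calc ∑ i, p i * Real.exp (-η i 0 * L i (0 + 1)) ≤ ∑ i, p i * (3 / 2) := by
          refine Finset.sum_le_sum fun i _ => mul_le_mul_of_nonneg_left ?_ (hp i).le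
          refine ((h i).exp_step_le (Nat.zero_le n)).trans ?_
          rw [(h i).init, mul_zero, Real.exp_zero]
          have := abs_le.1 ((h i).abs_rate_mul_loss_le (Nat.zero_le n))
          linarith
      _ = 3 / 2 := by rw [← Finset.sum_mul, hp1, one_mul]
  have hchange : ∀ t, ∑ i, p i * Real.exp (-η i (t + 1) * L i (t + 1)) =
      ∑ i, p i * Real.exp (-η i t * L i (t + 1)) + ∑ i, p i * rateLoss (η i) (L i) (t + 1)
        - ∑ i, p i * rateLoss (η i) (L i) t := by
    intro t
    rw [← Finset.sum_add_distrib, ← Finset.sum_sub_distrib]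
    exact Finset.sum_congr rfl fun i _ => by rw [rateLoss_succ]; ring
  have hind : ∀ t, t + 1 ≤ n → ∑ i, p i * Real.exp (-η i (t + 1) * L i (t + 1)) ≤
      3 / 2 + ∑ i, p i * rateLoss (η i) (L i) (t + 1) := by
    intro t
    induction t with
    | zero =>
      intro _
      rw [hchange]
      simp only [rateLoss, Finset.Icc_eq_empty_of_lt Nat.zero_lt_one, Finset.sum_empty, mul_zero,
        Finset.sum_const_zero] at hfirst ⊢
      linarith
    | succ t ih =>
      intro ht
      rw [hchange]
      have := ih (by omega)
      have := hstep (t + 1) (by omega) (by omega)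
      linarith
  obtain ⟨m, rfl⟩ : ∃ m, n = m + 1 := ⟨n - 1, by omega⟩
  exact (hstep _ hn le_rfl).trans (hind m le_rfl)

lemma sum_exp_le_of_rateLoss_le (hp : ∀ i, 0 < p i) (hp1 : ∑ i, p i = 1)
    (h : ∀ i, IsBOATrack (ℓ i) (η i) (L i) (E i) (Real.log (p i)⁻¹) n)
    (hbal : ∀ t, 1 ≤ t → t ≤ n →
      ∑ i, η i t * Real.exp (-η i t * L i t) * p i * ℓ i (t + 1) = 0) (hn : 1 ≤ n)
    {D : ℝ} (hD : ∀ i, rateLoss (η i) (L i) n ≤ D) (j : ι) :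
    Real.exp (-Real.log (p j)⁻¹) * Real.exp (-η j n * L j (n + 1)) ≤ 3 / 2 + D := by
  have h1 : Real.exp (-Real.log (p j)⁻¹) = p j := by
    rw [Real.log_inv, neg_neg, Real.exp_log (hp j)]
  rw [h1]
  calc p j * Real.exp (-η j n * L j (n + 1)) ≤ ∑ i, p i * Real.exp (-η i n * L i (n + 1)) :=
        Finset.single_le_sum (f := fun i => p i * Real.exp (-η i n * L i (n + 1)))
          (fun i _ => mul_nonneg (hp i).le (Real.exp_pos _).le) (Finset.mem_univ j)
    _ ≤ 3 / 2 + ∑ i, p i * rateLoss (η i) (L i) n := sum_exp_le hp hp1 h hbal hn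
    _ ≤ 3 / 2 + ∑ i, p i * D := by
        gcongr with i
        · exact (hp i).le
        · exact hD i
    _ = 3 / 2 + D := by rw [← Finset.sum_mul, hp1, one_mul]

lemma one_sub_le_log_inv {x : ℝ} (hx : 0 < x) : 1 - x ≤ Real.log x⁻¹ := by
  rw [Real.log_inv]; linarith [Real.log_le_sub_one_of_pos hx]

lemma neg_sum_le_regretBound_of_two_le (hp : ∀ i, 0 < p i) (hp1 : ∑ i, p i = 1)
    (h : ∀ i, IsBOATrack (ℓ i) (η i) (L i) (E i) (Real.log (p i)⁻¹) n)
    (hbal : ∀ t, 1 ≤ t → t ≤ n →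
      ∑ i, η i t * Real.exp (-η i t * L i t) * p i * ℓ i (t + 1) = 0) (hn : 2 ≤ n) (j : ι) :
    -∑ t ∈ Finset.Icc 1 (n + 1), ℓ j t ≤
      regretBound (E j) (Real.log (p j)⁻¹) (cumSq (ℓ j) (n + 1)) n := by
  have hs := Real.sqrt_pos.2 (h j).cost_pos
  rcases Nat.lt_or_ge n 8 with h8 | h8
  · exact (h j).neg_sum_le_regretBound_of_sqrt_le
      (sqrt_succ_le_of_le_seven hn (Nat.le_of_lt_succ h8) hs)
  have h8' : (8 : ℝ) ≤ n := by exact_mod_cast h8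
  by_cases hall : ∀ i, 1 / n ≤ Real.log (p i)⁻¹
  · apply (h j).neg_sum_le_regretBound_of_exp_le
    have := sum_exp_le_of_rateLoss_le hp hp1 h hbal (by omega)
      (fun i => (h i).rateLoss_le_of_le_cost h8 (hall i)) j
    linarith
  push Not at hall
  obtain ⟨i, hi⟩ := hall
  by_cases hij : j = i
  · subst hij
    apply (h j).neg_sum_le_regretBound_of_sqrt_le
    apply sqrt_succ_le_of_sq_le h8 hs
    rw [Real.sq_sqrt (h j).cost_pos.le]
    exact hi.le
  · have hpair : p j + p i ≤ 1 := by
      rw [← hp1]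
      exact Finset.add_le_sum (fun k _ => (hp k).le) (Finset.mem_univ j) (Finset.mem_univ i) hij
    have h1 := one_sub_le_log_inv (hp i)
    have h2 : Real.log n ≤ Real.log (p j)⁻¹ := by
      apply Real.log_le_log (by linarith)
      rw [le_inv_comm₀ (by linarith) (hp j), ← one_div]
      linarith
    have h3 := mul_log_two_le_log (n := n) (k := 3) (by omega)
    norm_num at h3
    apply (h j).neg_sum_le_regretBound_of_exp_le_of_two_le (by linarith)
    have h4 := sum_exp_le_of_rateLoss_le hp hp1 h hbal (by omega)
      (fun i => (h i).rateLoss_le h8) j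
    have h5 := Real.quadratic_le_exp_of_nonneg (x := 1 / 2) (by norm_num)
    have h6 : 13 / 8 * (1 + Real.log n / 2) ≤ Real.exp (1 / 2) * (1 + Real.log n / 2) := by
      gcongr
      · linarith
    linarith

lemma neg_sum_le_regretBound_one (hp : ∀ i, 0 < p i) (hp1 : ∑ i, p i = 1)
    (h : ∀ i, IsBOATrack (ℓ i) (η i) (L i) (E i) (Real.log (p i)⁻¹) 1)
    (hbal : ∑ i, η i 1 * Real.exp (-η i 1 * L i 1) * p i * ℓ i 2 = 0) (j : ι) :
    -∑ t ∈ Finset.Icc 1 2, ℓ j t ≤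
      regretBound (E j) (Real.log (p j)⁻¹) (cumSq (ℓ j) 2) 1 := by
  have hB : adaptCost 1 = 0 := by simp [adaptCost]
  have hl := (h j).cost_pos
  have hE := (h j).range_pos
  have hs := Real.sqrt_pos.2 hl
  have h2 : Real.sqrt 2 * Real.sqrt 2 = 2 := Real.mul_self_sqrt (by norm_num)
  have hs2 : Real.sqrt 2 ≤ 1.415 := Real.sqrt_le_iff.2 (by norm_num)
  set lam := Real.log (p j)⁻¹ with hlam
  have hV := Real.sqrt_nonneg (cumSq (ℓ j) 2)
  rw [regretBound_eq, hB]
  simp only [zero_div, add_zero, mul_zero]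
  rcases le_total (Real.sqrt 2 - 1) (Real.sqrt lam) with hc | hc
  · have h1 := neg_sum_le_sqrt_mul (ℓ j) 2
    push_cast at h1
    have h3 : Real.sqrt 2 ≤ (2 + Real.sqrt 2) * Real.sqrt lam := by
      nlinarith [Real.sqrt_nonneg 2]
    nlinarith [mul_pos hE hl]
  · have hlam2 : lam ≤ 0.173 := by
      have := Real.sq_sqrt hl.le
      nlinarith
    have hsum : ∑ t ∈ Finset.Icc 1 2, ℓ j t = ℓ j 1 + ℓ j 2 := by
      simp [Finset.sum_Icc_succ_top]
    have ha := abs_le.1 ((h j).abs_bound 1 (by simp))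
    have hb := abs_le.1 ((h j).abs_bound 2 (by simp))
    have hF : E j + 2 * E j * lam + Real.sqrt lam * Real.sqrt (cumSq (ℓ j) 2) ≤
        Real.sqrt (cumSq (ℓ j) 2) * ((2 + Real.sqrt 2) * Real.sqrt lam) +
          E j * (2 * lam + 1) := by
      nlinarith [mul_nonneg (mul_nonneg hV hs.le) (Real.sqrt_nonneg 2), mul_nonneg hV hs.le]
    have hF0 : 0 ≤ 2 * E j * lam + Real.sqrt lam * Real.sqrt (cumSq (ℓ j) 2) := by positivity
    rw [hsum]
    rcases le_total 0 (ℓ j 1) with ha0 | ha0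
    · linarith
    rcases le_total 0 (ℓ j 2) with hb0 | hb0
    · linarith
    have hη := (h j).rate_pos le_rfl
    have hLj : L j 1 ≤ 0 := by
      have h3 := (h j).step 0 (by norm_num)
      have h4 := abs_le.1 ((h j).abs_rate_mul_loss_le (t := 0) (by norm_num))
      rw [(h j).init] at h3
      norm_num at h3 h4
      rw [h3]
      exact mul_nonpos_of_nonpos_of_nonneg ha0 (by linarith)
    have hexp : Real.exp (1 / 4) ≤ 4 / 3 := by
      have h3 := Real.one_sub_le_exp_neg (1 / 4)
      rw [Real.exp_neg, le_inv_comm₀ (by norm_num) (Real.exp_pos _)] at h3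
      norm_num at h3 ⊢
      exact h3
    have hterm : ∀ i, η i 1 * Real.exp (-η i 1 * L i 1) * p i * ℓ i 2 ≤ 2 / 3 * p i := by
      intro i
      have hEi := (h i).range_pos
      have hηi := (h i).rate_pos le_rfl
      have h3 := (h i).step 0 (by norm_num)
      rw [(h i).init, (h i).rate_zero] at h3
      norm_num at h3
      have h4 : -L i 1 ≤ E i / 2 := by
        rw [h3]
        have : E i / 2 + ℓ i 1 * (1 + (E i)⁻¹ * (1 / 2) * ℓ i 1) =
            (E i + ℓ i 1) ^ 2 / (2 * E i) := by
          field_simp; ring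
        have h5 : 0 ≤ (E i + ℓ i 1) ^ 2 / (2 * E i) := by positivity
        linarith
      have h5 := (h i).rate_mul_le le_rfl
      have h6 : Real.exp (-η i 1 * L i 1) ≤ 4 / 3 := by
        refine le_trans (Real.exp_le_exp.2 ?_) hexp
        nlinarith
      have h7 : η i 1 * ℓ i 2 ≤ 1 / 2 :=
        (le_abs_self _).trans ((h i).abs_rate_mul_loss_le le_rfl)
      calc η i 1 * Real.exp (-η i 1 * L i 1) * p i * ℓ i 2 =
          Real.exp (-η i 1 * L i 1) * p i * (η i 1 * ℓ i 2) := by ring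
        _ ≤ Real.exp (-η i 1 * L i 1) * p i * (1 / 2) :=
          mul_le_mul_of_nonneg_left h7 (mul_pos (Real.exp_pos _) (hp i)).le
        _ ≤ 4 / 3 * p i * (1 / 2) := by
          have := hp i
          gcongr
        _ = 2 / 3 * p i := by ring
    classical
    have hother : -(η j 1 * Real.exp (-η j 1 * L j 1) * p j * ℓ j 2) ≤ 2 / 3 * (1 - p j) := by
      rw [← Finset.add_sum_erase _ _ (Finset.mem_univ j)] at hbal hp1
      have h3 := Finset.sum_le_sum (s := Finset.univ.erase j) fun i _ => hterm i
      rw [← Finset.mul_sum] at h3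
      linarith
    have hpj := hp j
    have h1p := one_sub_le_log_inv hpj
    have hexp1 : 1 ≤ Real.exp (-η j 1 * L j 1) := Real.one_le_exp (by nlinarith)
    have h3 : η j 1 * -ℓ j 2 ≤ lam := by
      have h4 : p j * (η j 1 * -ℓ j 2) ≤ 2 / 3 * (1 - p j) := by
        refine le_trans ?_ hother
        have h5 : 0 ≤ p j * (η j 1 * -ℓ j 2) :=
          mul_nonneg hpj.le (mul_nonneg hη.le (by linarith))
        nlinarith
      have h5 : 0.827 ≤ p j := by norm_num at hlam2 ⊢; linarith
      have h6 : 0 ≤ η j 1 * -ℓ j 2 := mul_nonneg hη.le (by linarith)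
      norm_num at h5
      nlinarith
    have h4 : -ℓ j 2 ≤ (η j 1)⁻¹ * lam := by rwa [le_inv_mul_iff₀ hη]
    have h5 : (η j 1)⁻¹ ≤ 2 * E j + Real.sqrt (cumSq (ℓ j) 2) / Real.sqrt lam := by
      rw [(h j).rate 1 le_rfl]
      refine (inv_boaRate_le hE hl (cumSq_nonneg _ _)).trans ?_
      gcongr
      exact cumSq_le_succ _ _
    have h6 : (2 * E j + Real.sqrt (cumSq (ℓ j) 2) / Real.sqrt lam) * lam =
        2 * E j * lam + Real.sqrt lam * Real.sqrt (cumSq (ℓ j) 2) := by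
      have := Real.mul_self_sqrt hl.le
      field_simp
      linear_combination (-Real.sqrt (cumSq (ℓ j) 2)) * this
    have h7 := mul_le_mul_of_nonneg_right h5 hl.le
    linarith

lemma neg_sum_le_regretBound (hp : ∀ i, 0 < p i) (hp1 : ∑ i, p i = 1)
    (h : ∀ i, IsBOATrack (ℓ i) (η i) (L i) (E i) (Real.log (p i)⁻¹) n)
    (hbal : ∀ t, 1 ≤ t → t ≤ n →
      ∑ i, η i t * Real.exp (-η i t * L i t) * p i * ℓ i (t + 1) = 0) (hn : 1 ≤ n) (j : ι) :
    -∑ t ∈ Finset.Icc 1 (n + 1), ℓ j t ≤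
      regretBound (E j) (Real.log (p j)⁻¹) (cumSq (ℓ j) (n + 1)) n := by
  rcases hn.eq_or_lt with rfl | hn
  · exact neg_sum_le_regretBound_one hp hp1 h (hbal 1 le_rfl le_rfl) j
  · exact neg_sum_le_regretBound_of_two_le hp hp1 h hbal hn j

end Experts

/-- **Second order regret bound for adaptive BOA with known ranges** (Theorem 5).
With known ranges `|ℓv j t| ≤ E j` and learning rates
`η j t = min (1/(2 E j)) (√(log(π₀ⱼ⁻¹)/∑_{s≤t} (ℓv j s)²))` (and `η j 0 = 1/(2 E j)`,
also used when the sum of squares vanishes), the adaptive BOA procedure satisfies, for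
every probability vector `q`:
`∑ₜ loss (y t) (yhat t) ≤ ∑ₜ loss (y t) (∑ⱼ qⱼ Yp j t)
  + ∑ⱼ qⱼ (√(∑ₜ (ℓv j t)²) (√(2 log π₀ⱼ⁻¹)/(√2-1) + Bₙ/√(log π₀ⱼ⁻¹))
            + E j (2 log π₀ⱼ⁻¹ + 2 Bₙ + 1))`, where `Bₙ = log(1 + log n / 2)`. -/
theorem boa_adaptive_known_ranges_regret_bound (M n : ℕ) (hM : 0 < M) (hn : 1 ≤ n)
    (E : Fin M → ℝ) (hE : ∀ j, 0 < E j)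
    (η : Fin M → ℕ → ℝ)
    (loss loss' : ℝ → ℝ → ℝ)
    (hconv : ∀ y : ℝ, ConvexOn ℝ Set.univ (loss y))
    (hsub : ∀ y u v : ℝ, loss y u + loss' y u * (v - u) ≤ loss y v)
    (y : ℕ → ℝ) (Yp : Fin M → ℕ → ℝ)
    (π : ℕ → Fin M → ℝ) (yhat : ℕ → ℝ) (ℓv L : Fin M → ℕ → ℝ)
    (hπ0pos : ∀ j, 0 < π 0 j) (hπ0lt : ∀ j, π 0 j < 1) (hπ0sum : ∑ j, π 0 j = 1)
    (hyhat : ∀ t ∈ Finset.Icc 1 (n + 1), yhat t = ∑ j, π (t - 1) j * Yp j t)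
    (hℓv : ∀ j, ∀ t ∈ Finset.Icc 1 (n + 1),
      ℓv j t = loss' (y t) (yhat t) * (Yp j t - yhat t))
    (hrange : ∀ j, ∀ t ∈ Finset.Icc 1 (n + 1), |ℓv j t| ≤ E j)
    (hη0 : ∀ j, η j 0 = 1 / (2 * E j))
    (hηdef : ∀ j, ∀ t ∈ Finset.Icc 1 n,
      η j t = if (∑ s ∈ Finset.Icc 1 t, (ℓv j s) ^ 2) = 0 then 1 / (2 * E j)
        else min (1 / (2 * E j))
          (Real.sqrt (Real.log (π 0 j)⁻¹ / ∑ s ∈ Finset.Icc 1 t, (ℓv j s) ^ 2)))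
    (hL0 : ∀ j, L j 0 = 0)
    (hL : ∀ j, ∀ t ∈ Finset.Icc 1 (n + 1),
      L j t = L j (t - 1) + ℓv j t * (1 + η j (t - 1) * ℓv j t))
    (hπ : ∀ j, ∀ t ∈ Finset.Icc 1 n,
      π t j = η j t * Real.exp (-η j t * L j t) * π 0 j /
        ∑ i, η i t * Real.exp (-η i t * L i t) * π 0 i)
    (q : Fin M → ℝ) (hq : ∀ j, 0 ≤ q j) (hqsum : ∑ j, q j = 1) :
    ∑ t ∈ Finset.Icc 1 (n + 1), loss (y t) (yhat t) ≤
      ∑ t ∈ Finset.Icc 1 (n + 1), loss (y t) (∑ j, q j * Yp j t)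
        + ∑ j, q j * (Real.sqrt (∑ t ∈ Finset.Icc 1 (n + 1), (ℓv j t) ^ 2) *
            (Real.sqrt (2 * Real.log (π 0 j)⁻¹) / (Real.sqrt 2 - 1)
              + Real.log (1 + Real.log n / 2) / Real.sqrt (Real.log (π 0 j)⁻¹))
          + E j * (2 * Real.log (π 0 j)⁻¹ + 2 * Real.log (1 + Real.log n / 2) + 1)) := by
  have htrack : ∀ j, IsBOATrack (ℓv j) (η j) (L j) (E j) (Real.log (π 0 j)⁻¹) n := fun j =>
    { range_pos := hE j
      cost_pos := Real.log_pos ((one_lt_inv₀ (hπ0pos j)).2 (hπ0lt j))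
      rate := by
        intro t ht
        rcases Nat.eq_zero_or_pos t with rfl | h0
        · rw [hη0, cumSq_zero, boaRate_zero]
        · exact hηdef j t (Finset.mem_Icc.2 ⟨h0, ht⟩)
      abs_bound := hrange j
      init := hL0 j
      step := by
        intro t ht
        exact hL j (t + 1) (Finset.mem_Icc.2 ⟨by omega, by omega⟩) }
  have hbal : ∀ t, 1 ≤ t → t ≤ n →
      ∑ i, η i t * Real.exp (-η i t * L i t) * π 0 i * ℓv i (t + 1) = 0 := by
    intro t h1 ht
    have hmem : t + 1 ∈ Finset.Icc 1 (n + 1) := Finset.mem_Icc.2 ⟨by omega, by omega⟩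
    have hne : (Finset.univ : Finset (Fin M)).Nonempty := ⟨⟨0, hM⟩, Finset.mem_univ _⟩
    have hZ : 0 < ∑ i, η i t * Real.exp (-η i t * L i t) * π 0 i :=
      Finset.sum_pos (fun i _ => mul_pos (mul_pos ((htrack i).rate_pos ht) (Real.exp_pos _))
        (hπ0pos i)) hne
    have hy := hyhat (t + 1) hmem
    rw [Nat.add_sub_cancel] at hy
    set Z := ∑ i, η i t * Real.exp (-η i t * L i t) * π 0 i with hZdef
    have hw : ∀ i, η i t * Real.exp (-η i t * L i t) * π 0 i = Z * π t i := by
      intro i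
      rw [hπ i t (Finset.mem_Icc.2 ⟨h1, ht⟩), mul_div_cancel₀ _ hZ.ne']
    have hsum : ∑ i, π t i = 1 := by
      have : Z * ∑ i, π t i = Z := by
        rw [Finset.mul_sum, hZdef]
        exact Finset.sum_congr rfl fun i _ => (hw i).symm
      exact mul_left_cancel₀ hZ.ne' (by rw [this, mul_one])
    calc ∑ i, η i t * Real.exp (-η i t * L i t) * π 0 i * ℓv i (t + 1)
        = Z * loss' (y (t + 1)) (yhat (t + 1)) *
          (∑ i, π t i * Yp i (t + 1) - yhat (t + 1) * ∑ i, π t i) := by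
          rw [Finset.mul_sum (f := fun i => π t i), ← Finset.sum_sub_distrib, Finset.mul_sum]
          refine Finset.sum_congr rfl fun i _ => ?_
          rw [hw i, hℓv i (t + 1) hmem]
          ring
      _ = 0 := by rw [hsum, ← hy]; ring
  have hreg := neg_sum_le_regretBound hπ0pos hπ0sum htrack hbal hn
  have hlin : ∑ t ∈ Finset.Icc 1 (n + 1), loss (y t) (yhat t) ≤
      ∑ t ∈ Finset.Icc 1 (n + 1), (loss (y t) (∑ j, q j * Yp j t) - ∑ j, q j * ℓv j t) := by
    refine Finset.sum_le_sum fun t ht => ?_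
    have h1 := hsub (y t) (yhat t) (∑ j, q j * Yp j t)
    have h2 : ∑ j, q j * ℓv j t = loss' (y t) (yhat t) * (∑ j, q j * Yp j t - yhat t) := by
      calc ∑ j, q j * ℓv j t = loss' (y t) (yhat t) *
            (∑ j, q j * Yp j t - yhat t * ∑ j, q j) := by
            rw [Finset.mul_sum (f := fun j => q j), ← Finset.sum_sub_distrib, Finset.mul_sum]
            refine Finset.sum_congr rfl fun j _ => ?_
            rw [hℓv j t ht]
            ring
        _ = _ := by rw [hqsum, mul_one]
    linarith
  refine hlin.trans ?_
  rw [Finset.sum_sub_distrib, sub_eq_add_neg, Finset.sum_comm, ← Finset.sum_neg_distrib]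
  gcongr with j
  rw [← Finset.mul_sum, ← mul_neg]
  exact mul_le_mul_of_nonneg_left (hreg j) (hq j)
end
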